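/- arXiv:2203.14770 — 5 statements merged into one kernel-verified Lean document; each statement's English description precedes it below -/
import Mathlib

section
/- Let n ≥ 2 and let F ⊆ S^{2n−1} be nonempty such that the standard suspension S₀(F) has a nonsparse leaf. If f : Bⁿ → ℂ satisfies (1) f ∈ C^∞(0) and (2) z ↦ f(zv) is holomorphic on B¹ for each v ∈ F, then the formal Taylor series of f at the origin is of holomorphic type, i.e., the coefficients C_I^J = (1/(I!J!)) ∂^{|I|+|J|} f/∂z^I ∂z̄^J (0) satisfy C_I^J = 0 whenever J ≠ 0. -/
open MeasureTheory Filter Metric Set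
open scoped ENNReal

noncomputable section

/-- The standard suspension `S₀(F) = {z • v : z ∈ B¹, v ∈ F}`. -/
def susp {n : ℕ} (F : Set (EuclideanSpace ℂ (Fin n))) : Set (EuclideanSpace ℂ (Fin n)) :=
  {w | ∃ z ∈ Metric.ball (0 : ℂ) 1, ∃ v ∈ F, w = z • v}

/-- Evaluation of a real polynomial in the real and imaginary parts of the coordinates. -/
def realEval {n : ℕ} (P : MvPolynomial (Fin n × Bool) ℝ) (z : EuclideanSpace ℂ (Fin n)) : ℝ :=
  MvPolynomial.eval (fun p => if p.2 then (z p.1).im else (z p.1).re) P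

/-- `v ∈ F̄` generates a nonsparse leaf of `S₀(F)`. -/
def GeneratesNonsparseLeaf {n : ℕ} (F : Set (EuclideanSpace ℂ (Fin n)))
    (v : EuclideanSpace ℂ (Fin n)) : Prop :=
  v ∈ closure F ∧
    ∀ V : Set (EuclideanSpace ℂ (Fin n)), IsOpen V → v ∈ V →
      ∀ P : MvPolynomial (Fin n × Bool) ℝ,
        (∀ w ∈ susp (V ∩ closure F), realEval P w = 0) → ∀ z, realEval P z = 0

/-- `f` is of class `C^k` near the origin for every `k`. -/
def SmoothAtOrigin {n : ℕ} (f : EuclideanSpace ℂ (Fin n) → ℂ) : Prop :=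
  ∀ k : ℕ, 0 < k → ∃ V : Set (EuclideanSpace ℂ (Fin n)),
    IsOpen V ∧ (0 : EuclideanSpace ℂ (Fin n)) ∈ V ∧ ContDiffOn ℝ k f V

-- Wirtinger machinery
/-- Wirtinger derivative `∂f/∂z_k` via real Fréchet derivatives. -/
def wDz {n : ℕ} (k : Fin n) (f : EuclideanSpace ℂ (Fin n) → ℂ)
    (z : EuclideanSpace ℂ (Fin n)) : ℂ :=
  (2 : ℂ)⁻¹ * (fderiv ℝ f z (EuclideanSpace.single k 1)
    - Complex.I * fderiv ℝ f z (EuclideanSpace.single k Complex.I))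

/-- Wirtinger derivative `∂f/∂z̄_k` via real Fréchet derivatives. -/
def wDzbar {n : ℕ} (k : Fin n) (f : EuclideanSpace ℂ (Fin n) → ℂ)
    (z : EuclideanSpace ℂ (Fin n)) : ℂ :=
  (2 : ℂ)⁻¹ * (fderiv ℝ f z (EuclideanSpace.single k 1)
    + Complex.I * fderiv ℝ f z (EuclideanSpace.single k Complex.I))

/-- Iterated Wirtinger derivative `∂^{|I|}/∂z^I`. -/
def wDzIter {n : ℕ} (I : Fin n → ℕ) (f : EuclideanSpace ℂ (Fin n) → ℂ) :
    EuclideanSpace ℂ (Fin n) → ℂ :=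
  List.foldr (fun k g => (wDz k)^[I k] g) f (List.finRange n)

/-- Iterated Wirtinger derivative `∂^{|J|}/∂z̄^J`. -/
def wDzbarIter {n : ℕ} (J : Fin n → ℕ) (f : EuclideanSpace ℂ (Fin n) → ℂ) :
    EuclideanSpace ℂ (Fin n) → ℂ :=
  List.foldr (fun k g => (wDzbar k)^[J k] g) f (List.finRange n)

/-- The mixed Taylor coefficient
`C_I^J = (1/(I! J!)) ∂^{|I|+|J|} f / ∂z^I ∂z̄^J (0)`. -/
def mixedCoeff {n : ℕ} (f : EuclideanSpace ℂ (Fin n) → ℂ) (I J : Fin n → ℕ) : ℂ :=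
  (((∏ i, (I i).factorial) * ∏ i, (J i).factorial : ℕ) : ℂ)⁻¹ *
    wDzIter I (wDzbarIter J f) 0

open scoped ContDiff Topology ComplexConjugate

theorem iteratedFDeriv_swap_aux {E G : Type*} [NormedAddCommGroup E] [NormedSpace ℝ E]
    [NormedAddCommGroup G] [NormedSpace ℝ G] (f : E → G) (N : ℕ) :
    ∀ x, ContDiffAt ℝ (N + 1 : ℕ) f x → ∀ (i : Fin N) (v : Fin (N + 1) → E),
      iteratedFDeriv ℝ (N + 1) f x (v ∘ Equiv.swap i.castSucc i.succ) =
        iteratedFDeriv ℝ (N + 1) f x v := by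
  induction N with
  | zero => intro x _ i; exact i.elim0
  | succ N ih =>
    intro x hx i v
    induction i using Fin.cases with
    | zero =>
      have h2 : ContDiffAt ℝ 2 (iteratedFDeriv ℝ N f) x := by
        apply hx.iteratedFDeriv_right
        norm_cast; omega
      have hs : IsSymmSndFDerivAt ℝ (iteratedFDeriv ℝ N f) x :=
        h2.isSymmSndFDerivAt (by simp)
      have hd : DifferentiableAt ℝ (fderiv ℝ (iteratedFDeriv ℝ N f)) x := by
        have : ContDiffAt ℝ 1 (fderiv ℝ (iteratedFDeriv ℝ N f)) x :=
          h2.fderiv_right (by norm_num)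
        exact this.differentiableAt (by norm_num)
      have key : ∀ w : Fin (N + 2) → E, iteratedFDeriv ℝ (N + 2) f x w =
          fderiv ℝ (fderiv ℝ (iteratedFDeriv ℝ N f)) x (w 0) (w 1)
            (fun j => w j.succ.succ) := by
        intro w
        rw [iteratedFDeriv_succ_apply_left]
        have hd1 : DifferentiableAt ℝ (iteratedFDeriv ℝ (N + 1) f) x :=
          hx.differentiableAt_iteratedFDeriv (by norm_cast; omega)
        rw [← fderiv_continuousMultilinear_apply_const_apply hd1]
        have e : (fun y => iteratedFDeriv ℝ (N + 1) f y (Fin.tail w)) =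
            fun y => fderiv ℝ (iteratedFDeriv ℝ N f) y (w 1) (fun j => w j.succ.succ) := rfl
        have hd2 : DifferentiableAt ℝ
            (fun y => fderiv ℝ (iteratedFDeriv ℝ N f) y (w 1)) x :=
          hd.clm_apply (differentiableAt_const _)
        rw [e, fderiv_continuousMultilinear_apply_const_apply hd2,
          fderiv_clm_apply hd (differentiableAt_const _)]
        simp
      rw [key, key]
      simp only [Function.comp]
      have e0 : (Equiv.swap (Fin.castSucc (0 : Fin (N+1))) (Fin.succ 0)) 0 = 1 :=
        Equiv.swap_apply_left _ _
      have e1 : (Equiv.swap (Fin.castSucc (0 : Fin (N+1))) (Fin.succ 0)) 1 = 0 :=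
        Equiv.swap_apply_right _ _
      have e2 : ∀ j : Fin N, (Equiv.swap (Fin.castSucc (0 : Fin (N+1))) (Fin.succ 0)) j.succ.succ
          = j.succ.succ := fun j => Equiv.swap_apply_of_ne_of_ne (by simp [Fin.ext_iff])
            (by simp [Fin.ext_iff])
      simp only [e0, e1, e2]
      rw [hs]
    | succ j =>
      have hd : DifferentiableAt ℝ (iteratedFDeriv ℝ (N + 1) f) x :=
        hx.differentiableAt_iteratedFDeriv (by norm_cast; omega)
      have ev : ∀ᶠ y in 𝓝 x, ContDiffAt ℝ (N + 1 : ℕ) f y :=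
        (hx.of_le (by norm_cast; omega)).eventually (by simp)
      have key : ∀ w : Fin (N + 1) → E, ∀ u : E,
          fderiv ℝ (iteratedFDeriv ℝ (N + 1) f) x u w =
          fderiv ℝ (fun y => iteratedFDeriv ℝ (N + 1) f y w) x u := by
        intro w u
        rw [fderiv_continuousMultilinear_apply_const_apply hd]
      rw [iteratedFDeriv_succ_apply_left, iteratedFDeriv_succ_apply_left, key, key]
      have e0 : (Equiv.swap (Fin.castSucc j.succ) (Fin.succ j.succ)) 0 = 0 :=
        Equiv.swap_apply_of_ne_of_ne (by simp [Fin.ext_iff]) (by simp [Fin.ext_iff])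
      have et : Fin.tail (v ∘ Equiv.swap (Fin.castSucc j.succ) (Fin.succ j.succ)) =
          (Fin.tail v) ∘ Equiv.swap j.castSucc j.succ := by
        funext m
        simp only [Fin.tail, Function.comp]
        congr 1
        simp only [Equiv.swap_apply_def, Fin.ext_iff, apply_ite Fin.val, Fin.val_succ,
          Fin.val_castSucc]
        split_ifs <;> omega
      rw [et]
      simp only [Function.comp, e0]
      congr 1
      apply Filter.EventuallyEq.fderiv_eq
      filter_upwards [ev] with y hy
      exact ih y hy j _

theorem iteratedFDeriv_perm_aux {E G : Type*} [NormedAddCommGroup E] [NormedSpace ℝ E]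
    [NormedAddCommGroup G] [NormedSpace ℝ G] (f : E → G) (N : ℕ) (x : E)
    (hx : ContDiffAt ℝ N f x) (σ : Equiv.Perm (Fin N)) (v : Fin N → E) :
    iteratedFDeriv ℝ N f x (fun i => v (σ i)) = iteratedFDeriv ℝ N f x v := by
  cases N with
  | zero => congr 1; funext i; exact i.elim0
  | succ N =>
    have hσ : σ ∈ Submonoid.closure (Set.range fun i : Fin N ↦ Equiv.swap i.castSucc i.succ) := by
      rw [Equiv.Perm.mclosure_swap_castSucc_succ]; trivial
    induction hσ using Submonoid.closure_induction generalizing v with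
    | mem y hy =>
      obtain ⟨i, rfl⟩ := hy
      exact iteratedFDeriv_swap_aux f N x hx i v
    | one => rfl
    | mul a b _ _ ha hb =>
      exact (hb (fun i => v (a i))).trans (ha v)

theorem eq_of_diag_aux {E G : Type*} [NormedAddCommGroup E] [NormedSpace ℝ E]
    [NormedAddCommGroup G] [NormedSpace ℝ G] (N : ℕ) (T : E [×N]→L[ℝ] G)
    (hs : ∀ (σ : Equiv.Perm (Fin N)) v, T (fun i => v (σ i)) = T v)
    (h : ∀ v, T (fun _ => v) = 0) : T = 0 := by
  ext v
  have := T.iteratedFDeriv_comp_diagonal 0 v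
  simp only [h, hs] at this
  rw [Finset.sum_const] at this
  have h0 : iteratedFDeriv ℝ N (fun _ : E => (0 : G)) 0 v = 0 := by
    have := iteratedFDeriv_fun_zero (𝕜 := ℝ) (E := E) (F := G) (n := N)
    rw [this]; rfl
  rw [h0] at this
  have h2 := this.symm
  rw [← Nat.cast_smul_eq_nsmul ℝ, smul_eq_zero] at h2
  rcases h2 with h2 | h2
  · simp [Fintype.card_perm, Nat.factorial_ne_zero] at h2
  · simpa using h2

theorem iteratedFDeriv_comp_right_aux {E E' G : Type*} [NormedAddCommGroup E] [NormedSpace ℝ E]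
    [NormedAddCommGroup E'] [NormedSpace ℝ E']
    [NormedAddCommGroup G] [NormedSpace ℝ G] (f : E → G) (N : ℕ) (g : E' →L[ℝ] E)
    (hf : ContDiffAt ℝ N f 0) :
    iteratedFDeriv ℝ N (fun z => f (g z)) 0 =
      (iteratedFDeriv ℝ N f 0).compContinuousLinearMap fun _ => g := by
  obtain ⟨U, hU, h0, hUf⟩ : ∃ U : Set E, IsOpen U ∧ (0 : E) ∈ U ∧ ContDiffOn ℝ N f U := by
    have := hf.eventually (by simp)
    obtain ⟨U, hU, hO, h0⟩ := _root_.eventually_nhds_iff.1 this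
    exact ⟨U, hO, h0, fun y hy => (hU y hy).contDiffWithinAt⟩
  have hg : IsOpen (g ⁻¹' U) := hU.preimage g.continuous
  have := g.iteratedFDerivWithin_comp_right hUf hU.uniqueDiffOn hg.uniqueDiffOn
    (x := 0) (by simpa using h0) (i := N) le_rfl
  rw [iteratedFDerivWithin_of_isOpen N hg (by simpa using h0),
    iteratedFDerivWithin_of_isOpen N hU (by simpa using h0), map_zero] at this
  exact this

/-- basis -/
def bvec {n : ℕ} (p : Fin n × Bool) : EuclideanSpace ℂ (Fin n) :=
  if p.2 then EuclideanSpace.single p.1 Complex.I else EuclideanSpace.single p.1 1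

/-- coords -/
def bco {n : ℕ} (z : EuclideanSpace ℂ (Fin n)) (p : Fin n × Bool) : ℝ :=
  if p.2 then (z p.1).im else (z p.1).re

theorem bexp {n : ℕ} (z : EuclideanSpace ℂ (Fin n)) : z = ∑ p, bco z p • bvec p := by
  rw [Fintype.sum_prod_type]
  ext i
  simp only [Fintype.sum_bool, bco, bvec]
  rw [WithLp.ofLp_sum, Finset.sum_apply, Finset.sum_eq_single i]
  · simp
    conv_lhs => rw [← Complex.re_add_im (z i)]
    ring
  · intro j _ hj
    simp [hj.symm]
  · simp

theorem exists_poly {n N : ℕ} (M : MultilinearMap ℝ (fun _ : Fin N => EuclideanSpace ℂ (Fin n)) ℝ) :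
    ∃ P : MvPolynomial (Fin n × Bool) ℝ, ∀ z, realEval P z = M (fun _ => z) := by
  classical
  refine ⟨∑ r : Fin N → Fin n × Bool,
    (∏ i, MvPolynomial.X (r i)) * MvPolynomial.C (M (fun i => bvec (r i))), fun z => ?_⟩
  have : M (fun _ => z) = M (fun _ => ∑ p, bco z p • bvec p) := by rw [← bexp]
  rw [this, MultilinearMap.map_sum]
  simp only [realEval, map_sum, map_mul, map_prod, MvPolynomial.eval_X, MvPolynomial.eval_C]
  refine Finset.sum_congr rfl fun r _ => ?_
  rw [MultilinearMap.map_smul_univ]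
  rfl

theorem main_scaling {n : ℕ}
    (F : Set (EuclideanSpace ℂ (Fin n)))
    (hnonsparse : ∃ v, GeneratesNonsparseLeaf F v)
    (f : EuclideanSpace ℂ (Fin n) → ℂ) (hf : ContDiffAt ℝ ∞ f 0)
    (hhol : ∀ v ∈ F, DifferentiableOn ℂ (fun z : ℂ => f (z • v)) (Metric.ball (0 : ℂ) 1))
    (N : ℕ) (ζ : ℂ) :
    iteratedFDeriv ℝ N (fun z => f (ζ • z)) 0 = ζ ^ N • iteratedFDeriv ℝ N f 0 := by
  have hfN : ContDiffAt ℝ N f 0 := contDiffAt_infty.1 hf N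
  let L : EuclideanSpace ℂ (Fin n) →L[ℝ] EuclideanSpace ℂ (Fin n) :=
    (ζ • ContinuousLinearMap.id ℂ (EuclideanSpace ℂ (Fin n))).restrictScalars ℝ
  have hL : ∀ z, L z = ζ • z := fun z => rfl
  set T := iteratedFDeriv ℝ N f 0 with hT
  have hTζ : iteratedFDeriv ℝ N (fun z => f (ζ • z)) 0 =
      T.compContinuousLinearMap fun _ => L := iteratedFDeriv_comp_right_aux f N L hfN
  rw [hTζ]
  have hsymm : ∀ (σ : Equiv.Perm (Fin N)) v, T (fun i => v (σ i)) = T v :=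
    fun σ v => iteratedFDeriv_perm_aux f N 0 hfN σ v
  -- homogeneity on F
  have hF : ∀ v ∈ F, ∀ c : ℂ, T (fun _ => c • v) = c ^ N * T (fun _ => v) := by
    intro v hv c
    let Lv : ℂ →L[ℝ] EuclideanSpace ℂ (Fin n) :=
      ((ContinuousLinearMap.id ℂ ℂ).smulRight v).restrictScalars ℝ
    have h1 : iteratedFDeriv ℝ N (fun z : ℂ => f (z • v)) 0 =
      T.compContinuousLinearMap fun _ => Lv := iteratedFDeriv_comp_right_aux f N Lv hfN
    have h2 : ContDiffAt ℂ N (fun z : ℂ => f (z • v)) 0 := by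
      have : AnalyticAt ℂ (fun z : ℂ => f (z • v)) 0 :=
        (hhol v hv).analyticAt (Metric.ball_mem_nhds _ one_pos)
      exact this.contDiffAt
    have h3 := h2.restrictScalars_iteratedFDeriv (𝕜 := ℝ)
    rw [h1] at h3
    have h4 : ∀ c : ℂ, T (fun _ => c • v) =
        iteratedFDeriv ℂ N (fun z : ℂ => f (z • v)) 0 (fun _ => c) := by
      intro c
      exact (DFunLike.congr_fun h3 (fun _ => c)).symm
    have h5 : T (fun _ => v) = T (fun _ => (1 : ℂ) • v) := by simp
    rw [h5, h4, h4]
    have := (iteratedFDeriv ℂ N (fun z : ℂ => f (z • v)) 0).map_smul_univ (fun _ => c) (fun _ => 1)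
    simpa using this
  have hFc : ∀ v ∈ closure F, ∀ c : ℂ, T (fun _ => c • v) = c ^ N * T (fun _ => v) := by
    intro v hv c
    have hcl : IsClosed {v | T (fun _ => c • v) = c ^ N * T (fun _ => v)} := by
      apply isClosed_eq
      · exact T.cont.comp (by fun_prop)
      · exact continuous_const.mul (T.cont.comp (by fun_prop))
    exact closure_minimal (fun v hv => hF v hv c) hcl hv
  obtain ⟨v₀, hv₀, hns⟩ := hnonsparse
  let R : ContinuousMultilinearMap ℝ (fun _ : Fin N => EuclideanSpace ℂ (Fin n)) ℂ :=
    T.compContinuousLinearMap (fun _ => L) - ζ ^ N • T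
  have hR : ∀ v, R v = T (fun i => ζ • v i) - ζ ^ N * T v := fun v => rfl
  have hRc : ∀ w ∈ susp (univ ∩ closure F), R (fun _ => w) = 0 := by
    rintro w ⟨z, -, v, ⟨-, hv⟩, rfl⟩
    rw [hR]
    simp only [smul_smul]
    rw [hFc v hv, hFc v hv]; ring
  have hlin : ∀ ℓ : ℂ →L[ℝ] ℝ, ∀ v, ℓ (R (fun _ => v)) = 0 := by
    intro ℓ v
    obtain ⟨P, hP⟩ := exists_poly (ℓ.compContinuousMultilinearMap R).toMultilinearMap
    have := hns univ isOpen_univ trivial P (fun w hw => by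
      rw [hP]
      change ℓ (R (fun _ => w)) = 0
      rw [hRc w hw, map_zero]) v
    rw [hP] at this
    exact this
  have hR0 : R = 0 := by
    apply eq_of_diag_aux
    · intro σ v
      rw [hR, hR, hsymm, hsymm σ (fun i => ζ • v i)]
    · intro v
      exact Complex.ext (hlin Complex.reCLM v) (hlin Complex.imCLM v)
  exact sub_eq_zero.1 hR0

/-- general Wirtinger type operator -/
def wOp {n : ℕ} (s : ℂ) (k : Fin n) (f : EuclideanSpace ℂ (Fin n) → ℂ)
    (z : EuclideanSpace ℂ (Fin n)) : ℂ :=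
  (2 : ℂ)⁻¹ * (fderiv ℝ f z (EuclideanSpace.single k 1)
    + s * fderiv ℝ f z (EuclideanSpace.single k Complex.I))

theorem wDz_eq {n : ℕ} (k : Fin n) : wDz k = wOp (-Complex.I) k := by
  funext f z; simp only [wDz, wOp]; ring

theorem wDzbar_eq {n : ℕ} (k : Fin n) : wDzbar k = wOp (Complex.I) k := rfl

/-- represented by the N-th derivative, scaling by c -/
def Good {n : ℕ} (ζ : ℂ) (N : ℕ) (c : ℂ)
    (D : (EuclideanSpace ℂ (Fin n) → ℂ) → EuclideanSpace ℂ (Fin n) → ℂ) : Prop :=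
  (∃ Φ : (EuclideanSpace ℂ (Fin n) [×N]→L[ℝ] ℂ) →L[ℝ] ℂ, (∀ (a : ℂ) T, Φ (a • T) = a * Φ T) ∧
    ∀ h, ContDiffAt ℝ ∞ h 0 → D h =ᶠ[𝓝 0] fun z => Φ (iteratedFDeriv ℝ N h z)) ∧
  ∀ f z, D (fun x => f (ζ • x)) z = c * D f (ζ • z)

theorem Good.id {n : ℕ} (ζ : ℂ) : Good (n := n) ζ 0 1 (fun f => f) := by
  refine ⟨⟨(continuousMultilinearCurryFin0 ℝ (EuclideanSpace ℂ (Fin n)) ℂ :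
    (EuclideanSpace ℂ (Fin n) [×0]→L[ℝ] ℂ) ≃L[ℝ] ℂ), ?_, ?_⟩, ?_⟩
  · intro a T; rfl
  · intro h _; exact Filter.EventuallyEq.of_eq rfl
  · intro f z; simp

theorem single_I_smul {n : ℕ} (k : Fin n) (ζ : ℂ) :
    ζ • (EuclideanSpace.single k (1 : ℂ)) =
      ζ.re • EuclideanSpace.single k (1 : ℂ) + ζ.im • EuclideanSpace.single k Complex.I := by
  ext i
  by_cases h : i = k
  · subst h; simp
  · simp [h]

theorem single_I_smul' {n : ℕ} (k : Fin n) (ζ : ℂ) :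
    ζ • (EuclideanSpace.single k Complex.I) =
      (-ζ.im) • EuclideanSpace.single k (1 : ℂ) + ζ.re • EuclideanSpace.single k Complex.I := by
  ext i
  by_cases h : i = k
  · subst h
    simp
    apply Complex.ext <;> simp
  · simp [h]

theorem Good.step {n : ℕ} {ζ : ℂ} (hζ : ζ ≠ 0) {N : ℕ} {c : ℂ}
    {D : (EuclideanSpace ℂ (Fin n) → ℂ) → EuclideanSpace ℂ (Fin n) → ℂ} (hD : Good ζ N c D)
    (s : ℂ) (hs : s * s = -1) (k : Fin n) :
    Good ζ (N + 1) ((ζ.re - s * ζ.im) * c) (fun f => wOp s k (D f)) := by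
  obtain ⟨⟨Φ, hΦ, hrep⟩, hsc⟩ := hD
  constructor
  · let A : EuclideanSpace ℂ (Fin n) →
        (EuclideanSpace ℂ (Fin n) [×(N+1)]→L[ℝ] ℂ) →L[ℝ] (EuclideanSpace ℂ (Fin n) [×N]→L[ℝ] ℂ) :=
      fun e => (ContinuousLinearMap.apply ℝ _ e).comp
        ((continuousMultilinearCurryLeftEquiv ℝ
          (fun _ : Fin (N + 1) => EuclideanSpace ℂ (Fin n)) ℂ).toContinuousLinearEquiv :
          _ →L[ℝ] _)
    have hA : ∀ e (a : ℂ) T, A e (a • T) = a • A e T := fun e a T => rfl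
    refine ⟨(2 : ℂ)⁻¹ • (Φ.comp (A (EuclideanSpace.single k 1)) +
      s • Φ.comp (A (EuclideanSpace.single k Complex.I))), ?_, ?_⟩
    · intro a T
      simp [hA, hΦ]; ring
    · intro h hh
      have h1 := hrep h hh
      have h2 : ∀ᶠ z in 𝓝 0, ContDiffAt ℝ (N + 1 : ℕ) h z :=
        (contDiffAt_infty.1 hh (N + 1)).eventually (by simp)
      filter_upwards [h1.eventuallyEq_nhds, h2] with z hz hz2
      have hd : DifferentiableAt ℝ (iteratedFDeriv ℝ N h) z :=
        hz2.differentiableAt_iteratedFDeriv (by norm_cast; omega)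
      have h3 : fderiv ℝ (D h) z = Φ.comp (fderiv ℝ (iteratedFDeriv ℝ N h) z) := by
        rw [hz.fderiv_eq]
        exact (Φ.hasFDerivAt.comp z hd.hasFDerivAt).fderiv
      simp only [wOp, h3]
      rfl
  · intro f z
    have e1 : D (fun x => f (ζ • x)) = fun z => c * D f (ζ • z) := funext (hsc f)
    let L : EuclideanSpace ℂ (Fin n) ≃L[ℝ] EuclideanSpace ℂ (Fin n) :=
      (ContinuousLinearEquiv.smulLeft (R₁ := ℂ) (M₁ := EuclideanSpace ℂ (Fin n))
        (Units.mk0 ζ hζ)).restrictScalars ℝ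
    have hLa : ∀ z, L z = ζ • z := fun z => rfl
    have e2 : fderiv ℝ (fun z => c * D f (ζ • z)) z =
        c • (fderiv ℝ (D f) (ζ • z)).comp (L : _ →L[ℝ] _) := by
      have := L.comp_right_fderiv (f := D f) (x := z)
      rw [hLa] at this
      rw [← this]
      exact congrFun (fderiv_const_smul_field (𝕜 := ℝ) (f := D f ∘ L) c) z
    simp only [wOp, e1, e2]
    simp only [ContinuousLinearMap.smul_apply, ContinuousLinearMap.comp_apply,
      ContinuousLinearEquiv.coe_coe, hLa, single_I_smul, single_I_smul', map_add, map_smul,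
      smul_eq_mul, Complex.real_smul]
    push_cast
    linear_combination (2 : ℂ)⁻¹ * c * ζ.im *
      fderiv ℝ (D f) (ζ • z) (EuclideanSpace.single k Complex.I) * hs

theorem Good.iter {n : ℕ} {ζ : ℂ} (hζ : ζ ≠ 0) {N : ℕ} {c : ℂ}
    {D : (EuclideanSpace ℂ (Fin n) → ℂ) → EuclideanSpace ℂ (Fin n) → ℂ} (hD : Good ζ N c D)
    (s : ℂ) (hs : s * s = -1) (k : Fin n) (m : ℕ) :
    Good ζ (N + m) ((ζ.re - s * ζ.im) ^ m * c) (fun f => (wOp s k)^[m] (D f)) := by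
  induction m with
  | zero => simpa using hD
  | succ m ih =>
    have := ih.step hζ s hs k
    simp only [Function.iterate_succ_apply']
    rw [pow_succ', mul_assoc]
    exact this

theorem Good.fold {n : ℕ} {ζ : ℂ} (hζ : ζ ≠ 0) {N : ℕ} {c : ℂ}
    {D : (EuclideanSpace ℂ (Fin n) → ℂ) → EuclideanSpace ℂ (Fin n) → ℂ} (hD : Good ζ N c D)
    (s : ℂ) (hs : s * s = -1) (I : Fin n → ℕ) (l : List (Fin n)) :
    Good ζ (N + (l.map I).sum) ((ζ.re - s * ζ.im) ^ (l.map I).sum * c)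
      (fun f => List.foldr (fun k g => (wOp s k)^[I k] g) (D f) l) := by
  induction l with
  | nil => simpa using hD
  | cons k l ih =>
    have := ih.iter hζ s hs k (I k)
    simp only [List.foldr_cons, List.map_cons, List.sum_cons]
    rw [pow_add, mul_assoc, add_comm (I k), ← add_assoc]
    exact this

/-- If the suspension `S₀(F)` has a nonsparse leaf, then the formal Taylor series at the
origin of any function smooth at the origin and holomorphic along `S₀(F)` is of
holomorphic type: `C_I^J = 0` whenever `J ≠ 0`. -/
theorem formal_series_of_holomorphic_type {n : ℕ} (hn : 2 ≤ n)
    (F : Set (EuclideanSpace ℂ (Fin n))) (hFne : F.Nonempty)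
    (hFsub : F ⊆ Metric.sphere (0 : EuclideanSpace ℂ (Fin n)) 1)
    (hnonsparse : ∃ v, GeneratesNonsparseLeaf F v)
    (f : EuclideanSpace ℂ (Fin n) → ℂ) (hf : SmoothAtOrigin f)
    (hhol : ∀ v ∈ F, DifferentiableOn ℂ (fun z : ℂ => f (z • v)) (Metric.ball (0 : ℂ) 1)) :
    ∀ I J : Fin n → ℕ, J ≠ 0 → mixedCoeff f I J = 0 := by
  intro I J hJ
  have hf' : ContDiffAt ℝ ∞ f 0 := by
    rw [contDiffAt_infty]
    intro k
    obtain ⟨V, hV, h0, hc⟩ := hf (k + 1) k.succ_pos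
    exact (hc.contDiffAt (hV.mem_nhds h0)).of_le (by norm_cast; omega)
  set q := ((List.finRange n).map J).sum with hq
  set p := ((List.finRange n).map I).sum with hp
  have hq0 : q ≠ 0 := by
    intro h
    apply hJ
    funext i
    rw [hq, List.sum_eq_zero_iff] at h
    exact h _ (List.mem_map.2 ⟨i, List.mem_finRange i, rfl⟩)
  obtain ⟨ζ, hζ⟩ : ∃ ζ : ℂ, ζ ^ q = Complex.I :=
    IsAlgClosed.exists_pow_nat_eq _ (Nat.pos_of_ne_zero hq0)
  have hζ0 : ζ ≠ 0 := by
    rintro rfl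
    rw [zero_pow hq0] at hζ
    exact Complex.I_ne_zero hζ.symm
  have hI : Complex.I * Complex.I = -1 := Complex.I_mul_I
  have g := ((Good.id (n := n) ζ).fold hζ0 Complex.I hI J (List.finRange n)).fold hζ0
    (-Complex.I) (by rw [neg_mul_neg, hI]) I (List.finRange n)
  obtain ⟨⟨Φ, hΦ, hrep⟩, hsc⟩ := g
  have hD : (fun f : EuclideanSpace ℂ (Fin n) → ℂ => wDzIter I (wDzbarIter J f)) =
    (fun f => List.foldr (fun k g => (wOp (-Complex.I) k)^[I k] g)
      (List.foldr (fun k g => (wOp Complex.I k)^[J k] g) f (List.finRange n))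
        (List.finRange n)) := by
    funext f
    simp only [wDzIter, wDzbarIter, wDz_eq, wDzbar_eq]
  have hDf : ∀ f : EuclideanSpace ℂ (Fin n) → ℂ, wDzIter I (wDzbarIter J f) = _ :=
    fun f => congrFun hD f
  have hfζ : ContDiffAt ℝ ∞ (fun z => f (ζ • z)) 0 := by
    apply ContDiffAt.comp (0 : EuclideanSpace ℂ (Fin n)) (g := f)
    · simpa using hf'
    · exact (contDiff_const_smul ζ).contDiffAt
  have a1 := (hrep f hf').eq_of_nhds
  have a2 := (hrep _ hfζ).eq_of_nhds
  have a3 := hsc f 0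
  rw [main_scaling F hnonsparse f hf' hhol, hΦ] at a2
  simp only [← hDf] at a1 a2 a3
  rw [smul_zero] at a3
  rw [a2, ← a1] at a3
  have c1 : (ζ.re : ℂ) - -Complex.I * ζ.im = ζ := by
    conv_rhs => rw [← Complex.re_add_im ζ]
    ring
  have c2 : (ζ.re : ℂ) - Complex.I * ζ.im = conj ζ := by
    apply Complex.ext <;> simp
  have c3 : (conj ζ) ^ q = -Complex.I := by rw [← map_pow, hζ, Complex.conj_I]
  rw [c1, c2, ← hp, ← hq, c3, zero_add, pow_add, hζ] at a3
  unfold mixedCoeff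
  have hp0 : ζ ^ p ≠ 0 := pow_ne_zero _ hζ0
  have : (2 * Complex.I * ζ ^ p) * wDzIter I (wDzbarIter J f) 0 = 0 := by
    linear_combination a3
  rcases mul_eq_zero.1 this with h | h
  · exfalso
    simp [hp0] at h
  · rw [h, mul_zero]

end
end

section
/- Let n ≥ 2 and let F ⊆ S^{2n−1} be nonempty such that S₀(F) is sparse, i.e., every v ∈ F̄ admits an open neighborhood U_v ⊆ S^{2n−1} and a nonconstant real polynomial P_v ∈ ℝ[x₁,y₁,…,xₙ,yₙ] vanishing identically on S₀(U_v ∩ F̄). Then there exists a nonconstant real polynomial P on ℂⁿ that vanishes identically on S₀(F); consequently P (restricted to Bⁿ) is smooth, holomorphic along S₀(F), and its formal Taylor series at 0 is not of holomorphic type, i.e., some coefficient C_I^J with J ≠ 0 is nonzero. Hence S₀(F) is not a formal Forelli suspension. -/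
open MeasureTheory Filter Metric Set
open scoped ENNReal

noncomputable section

/-- evaluation of a polynomial in z and conj z -/
def cEval {n : ℕ} (Q : MvPolynomial (Fin n × Bool) ℂ) (z : EuclideanSpace ℂ (Fin n)) : ℂ :=
  MvPolynomial.eval (fun p => if p.2 then (starRingEnd ℂ) (z p.1) else z p.1) Q

def coordCLM {n : ℕ} (p : Fin n × Bool) : EuclideanSpace ℂ (Fin n) →L[ℝ] ℂ :=
  if p.2 then (Complex.conjCLE : ℂ →L[ℝ] ℂ).comp ((EuclideanSpace.proj (𝕜 := ℂ) p.1).restrictScalars ℝ)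
  else ((EuclideanSpace.proj (𝕜 := ℂ) p.1).restrictScalars ℝ)

lemma coordCLM_apply {n : ℕ} (p : Fin n × Bool) (z : EuclideanSpace ℂ (Fin n)) :
    coordCLM p z = if p.2 then (starRingEnd ℂ) (z p.1) else z p.1 := by
  unfold coordCLM
  split_ifs <;> simp

lemma cEval_coord {n : ℕ} (Q : MvPolynomial (Fin n × Bool) ℂ) (z : EuclideanSpace ℂ (Fin n)) :
    cEval Q z = MvPolynomial.eval (fun p => coordCLM p z) Q := by
  simp [cEval, coordCLM_apply]

lemma cEval_C {n : ℕ} (a : ℂ) : cEval (n := n) (MvPolynomial.C a) = fun _ => a := by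
  funext z; simp [cEval]
lemma cEval_zero {n : ℕ} (z : EuclideanSpace ℂ (Fin n)) : cEval 0 z = 0 := by simp [cEval]
lemma cEval_one {n : ℕ} (z : EuclideanSpace ℂ (Fin n)) : cEval 1 z = 1 := by simp [cEval]
lemma cEval_add {n : ℕ} (p q : MvPolynomial (Fin n × Bool) ℂ) :
    cEval (p + q) = cEval p + cEval q := by
  funext z; simp [cEval]
lemma cEval_mul {n : ℕ} (p q : MvPolynomial (Fin n × Bool) ℂ) :
    cEval (p * q) = cEval p * cEval q := by
  funext z; simp [cEval]
lemma cEval_X {n : ℕ} (p : Fin n × Bool) :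
    cEval (MvPolynomial.X p) = coordCLM p := by
  funext z; simp [cEval_coord]

lemma contDiff_cEval {n : ℕ} (k : WithTop ℕ∞) (Q : MvPolynomial (Fin n × Bool) ℂ) :
    ContDiff ℝ k (cEval Q) := by
  induction Q using MvPolynomial.induction_on with
  | C a => rw [cEval_C]; exact contDiff_const
  | add p q hp hq => rw [cEval_add]; exact hp.add hq
  | mul_X p i hp => rw [cEval_mul, cEval_X]; exact hp.mul (coordCLM i).contDiff

lemma differentiable_cEval {n : ℕ} (Q : MvPolynomial (Fin n × Bool) ℂ) :
    Differentiable ℝ (cEval Q) := (contDiff_cEval 1 Q).differentiable (by simp)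

lemma fderiv_cEval_mulX {n : ℕ} (p : MvPolynomial (Fin n × Bool) ℂ) (i : Fin n × Bool)
    (z v : EuclideanSpace ℂ (Fin n)) :
    fderiv ℝ (cEval (p * MvPolynomial.X i)) z v
      = cEval p z * coordCLM i v + coordCLM i z * fderiv ℝ (cEval p) z v := by
  rw [cEval_mul, cEval_X, fderiv_mul (differentiable_cEval p z) (coordCLM i).differentiableAt]
  simp

lemma fderiv_cEval_add {n : ℕ} (p q : MvPolynomial (Fin n × Bool) ℂ)
    (z v : EuclideanSpace ℂ (Fin n)) :
    fderiv ℝ (cEval (p + q)) z v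
      = fderiv ℝ (cEval p) z v + fderiv ℝ (cEval q) z v := by
  rw [cEval_add, fderiv_add (differentiable_cEval p z) (differentiable_cEval q z)]
  simp

lemma wDz_cEval {n : ℕ} (k : Fin n) (Q : MvPolynomial (Fin n × Bool) ℂ) :
    wDz k (cEval Q) = cEval (MvPolynomial.pderiv (k, false) Q) := by
  funext z
  induction Q using MvPolynomial.induction_on with
  | C a => rw [cEval_C]; simp [wDz, cEval]
  | add p q hp hq =>
    rw [map_add, cEval_add (MvPolynomial.pderiv _ p), Pi.add_apply, ← hp, ← hq]
    simp only [wDz, fderiv_cEval_add]; ring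
  | mul_X p i hp =>
    rw [Derivation.leibniz, cEval_add, smul_eq_mul, smul_eq_mul, cEval_mul p (MvPolynomial.pderiv _ _),
      cEval_mul (MvPolynomial.X i) (MvPolynomial.pderiv _ _),
      Pi.add_apply, Pi.mul_apply, Pi.mul_apply, ← hp, cEval_X, MvPolynomial.pderiv_X]
    simp only [wDz, fderiv_cEval_mulX]
    obtain ⟨j, b⟩ := i
    have hI := Complex.I_mul_I
    by_cases hj : j = k
    · subst hj
      cases b
      · simp [coordCLM_apply, cEval_one]
        linear_combination (-1/2 * cEval p z) * hI
      · simp [coordCLM_apply, cEval_zero]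
        linear_combination (1/2 * cEval p z) * hI
    · cases b <;> simp [coordCLM_apply, cEval_zero, hj] <;> ring

lemma wDzbar_cEval {n : ℕ} (k : Fin n) (Q : MvPolynomial (Fin n × Bool) ℂ) :
    wDzbar k (cEval Q) = cEval (MvPolynomial.pderiv (k, true) Q) := by
  funext z
  induction Q using MvPolynomial.induction_on with
  | C a => rw [cEval_C]; simp [wDzbar, cEval]
  | add p q hp hq =>
    rw [map_add, cEval_add (MvPolynomial.pderiv _ p), Pi.add_apply, ← hp, ← hq]
    simp only [wDzbar, fderiv_cEval_add]; ring
  | mul_X p i hp =>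
    rw [Derivation.leibniz, cEval_add, smul_eq_mul, smul_eq_mul, cEval_mul p (MvPolynomial.pderiv _ _),
      cEval_mul (MvPolynomial.X i) (MvPolynomial.pderiv _ _),
      Pi.add_apply, Pi.mul_apply, Pi.mul_apply, ← hp, cEval_X, MvPolynomial.pderiv_X]
    simp only [wDzbar, fderiv_cEval_mulX]
    obtain ⟨j, b⟩ := i
    have hI := Complex.I_mul_I
    by_cases hj : j = k
    · subst hj
      cases b
      · simp [coordCLM_apply, cEval_zero]
        linear_combination (1/2 * cEval p z) * hI
      · simp [coordCLM_apply, cEval_one]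
        linear_combination (-1/2 * cEval p z) * hI
    · cases b <;> simp [coordCLM_apply, cEval_zero, hj] <;> ring

def polyIter {n : ℕ} (b : Bool) (I : Fin n → ℕ) (l : List (Fin n))
    (Q : MvPolynomial (Fin n × Bool) ℂ) : MvPolynomial (Fin n × Bool) ℂ :=
  List.foldr (fun k g => (MvPolynomial.pderiv (k, b))^[I k] g) Q l

lemma wDzIter_cEval {n : ℕ} (I : Fin n → ℕ) (Q : MvPolynomial (Fin n × Bool) ℂ) :
    wDzIter I (cEval Q) = cEval (polyIter false I (List.finRange n) Q) := by
  unfold wDzIter polyIter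
  induction (List.finRange n) with
  | nil => rfl
  | cons k l ih =>
    simp only [List.foldr_cons]
    rw [ih]
    generalize List.foldr _ Q l = R
    induction I k with
    | zero => rfl
    | succ a iha => rw [Function.iterate_succ_apply', iha, wDz_cEval, Function.iterate_succ_apply']

lemma wDzbarIter_cEval {n : ℕ} (I : Fin n → ℕ) (Q : MvPolynomial (Fin n × Bool) ℂ) :
    wDzbarIter I (cEval Q) = cEval (polyIter true I (List.finRange n) Q) := by
  unfold wDzbarIter polyIter
  induction (List.finRange n) with
  | nil => rfl
  | cons k l ih =>
    simp only [List.foldr_cons]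
    rw [ih]
    generalize List.foldr _ Q l = R
    induction I k with
    | zero => rfl
    | succ a iha =>
      rw [Function.iterate_succ_apply', iha, wDzbar_cEval, Function.iterate_succ_apply']

lemma coeff_iter {n : ℕ} (p : Fin n × Bool) (a : ℕ) (Q : MvPolynomial (Fin n × Bool) ℂ)
    (m : Fin n × Bool →₀ ℕ) :
    ((MvPolynomial.pderiv p)^[a] Q).coeff m ≠ 0 ↔ Q.coeff (m + Finsupp.single p a) ≠ 0 := by
  induction a generalizing m with
  | zero => simp
  | succ a ih =>
    rw [Function.iterate_succ_apply', MvPolynomial.coeff_pderiv, mul_ne_zero_iff, ih, add_assoc,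
      ← Finsupp.single_add, add_comm 1 a]
    have : ((m p : ℂ) + 1) ≠ 0 := by exact_mod_cast Nat.succ_ne_zero (m p)
    simp [this]

lemma coeff_polyIter {n : ℕ} (b : Bool) (I : Fin n → ℕ) (l : List (Fin n))
    (Q : MvPolynomial (Fin n × Bool) ℂ) (m : Fin n × Bool →₀ ℕ) :
    (polyIter b I l Q).coeff m ≠ 0 ↔
      Q.coeff (m + (l.map (fun k => Finsupp.single (k, b) (I k))).sum) ≠ 0 := by
  induction l generalizing m with
  | nil => simp [polyIter]
  | cons k l ih =>
    have : polyIter b I (k :: l) Q = (MvPolynomial.pderiv (k, b))^[I k] (polyIter b I l Q) := rfl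
    rw [this, coeff_iter, ih, List.map_cons, List.sum_cons, add_assoc]

lemma mixedCoeff_cEval {n : ℕ} (Q : MvPolynomial (Fin n × Bool) ℂ) (m : Fin n × Bool →₀ ℕ)
    (hm : Q.coeff m ≠ 0) :
    mixedCoeff (cEval Q) (fun k => m (k, false)) (fun k => m (k, true)) ≠ 0 := by
  unfold mixedCoeff
  refine mul_ne_zero (inv_ne_zero ?_) ?_
  · exact_mod_cast mul_ne_zero (Finset.prod_ne_zero_iff.2 fun i _ => Nat.factorial_ne_zero _)
      (Finset.prod_ne_zero_iff.2 fun i _ => Nat.factorial_ne_zero _)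
  · rw [wDzbarIter_cEval, wDzIter_cEval]
    have h0 : ∀ R : MvPolynomial (Fin n × Bool) ℂ, cEval R 0 = R.coeff 0 := by
      intro R
      have : (fun p : Fin n × Bool => coordCLM p (0 : EuclideanSpace ℂ (Fin n))) = 0 := by
        funext p; simp
      rw [cEval_coord, this, ← MvPolynomial.constantCoeff_eq]
      exact congrFun (congrArg _ MvPolynomial.eval_zero) R
    rw [h0, coeff_polyIter, coeff_polyIter]
    convert hm
    rw [← List.ofFn_eq_map, ← List.ofFn_eq_map, List.sum_ofFn, List.sum_ofFn]
    ext ⟨k, b⟩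
    cases b <;> simp [Finsupp.single_apply]

/-- rewriting a real polynomial in terms of z and conj z -/
def toC {n : ℕ} (P : MvPolynomial (Fin n × Bool) ℝ) : MvPolynomial (Fin n × Bool) ℂ :=
  MvPolynomial.aeval (fun p : Fin n × Bool =>
    if p.2 then MvPolynomial.C (-Complex.I / 2) * (MvPolynomial.X (p.1, false) - MvPolynomial.X (p.1, true))
    else MvPolynomial.C (1 / 2) * (MvPolynomial.X (p.1, false) + MvPolynomial.X (p.1, true))) P

lemma cEval_toC {n : ℕ} (P : MvPolynomial (Fin n × Bool) ℝ) :
    (fun z => ((realEval P z : ℝ) : ℂ)) = cEval (toC P) := by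
  funext z
  induction P using MvPolynomial.induction_on with
  | C a => simp [realEval, toC, cEval]
  | add p q hp hq =>
    simp only [realEval, toC, cEval, map_add, Complex.ofReal_add] at *
    rw [hp, hq]
  | mul_X p i hp =>
    simp only [realEval, toC, cEval, map_mul, Complex.ofReal_mul] at *
    rw [hp]
    congr 1
    obtain ⟨j, b⟩ := i
    apply Complex.ext <;> cases b <;> simp <;> ring

lemma exists_realEval_ne {n : ℕ} (P : MvPolynomial (Fin n × Bool) ℝ) (hP : P ≠ 0) :
    ∃ z, realEval P z ≠ 0 := by
  by_contra! h
  apply hP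
  apply MvPolynomial.funext
  intro x
  have := h (WithLp.toLp 2 fun k => ⟨x (k, false), x (k, true)⟩)
  simp only [realEval] at this
  rw [map_zero, ← this]
  congr 1
  congr 1
  funext ⟨k, b⟩
  cases b <;> simp

/-- If `S₀(F)` is sparse, then there is a nonconstant real polynomial `P` vanishing on
`S₀(F)`; it is smooth, holomorphic along `S₀(F)`, and its formal Taylor series at `0` is
not of holomorphic type. Hence `S₀(F)` is not a formal Forelli suspension. -/
theorem sparse_not_formal_forelli {n : ℕ} (hn : 2 ≤ n)
    (F : Set (EuclideanSpace ℂ (Fin n))) (hFne : F.Nonempty)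
    (hFsub : F ⊆ Metric.sphere (0 : EuclideanSpace ℂ (Fin n)) 1)
    (hsparse : ∀ v ∈ closure F, ∃ V : Set (EuclideanSpace ℂ (Fin n)), IsOpen V ∧ v ∈ V ∧
      ∃ P : MvPolynomial (Fin n × Bool) ℝ, (∀ c : ℝ, P ≠ MvPolynomial.C c) ∧
        ∀ w ∈ susp (V ∩ closure F), realEval P w = 0) :
    ∃ P : MvPolynomial (Fin n × Bool) ℝ, (∀ c : ℝ, P ≠ MvPolynomial.C c) ∧
      (∀ w ∈ susp F, realEval P w = 0) ∧
      SmoothAtOrigin (fun z => ((realEval P z : ℝ) : ℂ)) ∧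
      (∀ v ∈ F, DifferentiableOn ℂ (fun z : ℂ => ((realEval P (z • v) : ℝ) : ℂ))
        (Metric.ball (0 : ℂ) 1)) ∧
      (∃ I J : Fin n → ℕ, J ≠ 0 ∧ mixedCoeff (fun z => ((realEval P z : ℝ) : ℂ)) I J ≠ 0) ∧
      ¬ (∀ f : EuclideanSpace ℂ (Fin n) → ℂ, SmoothAtOrigin f →
          (∀ v ∈ F, DifferentiableOn ℂ (fun z : ℂ => f (z • v)) (Metric.ball (0 : ℂ) 1)) →
          ∀ I J : Fin n → ℕ, J ≠ 0 → mixedCoeff f I J = 0) := by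
  have hcomp : IsCompact (closure F) := by
    apply IsCompact.of_isClosed_subset (isCompact_sphere (0 : EuclideanSpace ℂ (Fin n)) 1)
      isClosed_closure
    exact closure_minimal hFsub Metric.isClosed_sphere
  choose! V hVo hvV Q hQc hQ using hsparse
  obtain ⟨t, ht, hcov⟩ := hcomp.elim_nhds_subcover V
    (fun v hv => (hVo v hv).mem_nhds (hvV v hv))
  let k0 : Fin n := ⟨0, by omega⟩
  let N : MvPolynomial (Fin n × Bool) ℝ :=
    MvPolynomial.X (k0, false) ^ 2 + MvPolynomial.X (k0, true) ^ 2
  let P := (∏ v ∈ t, Q v) * N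
  have hQ0 : (∏ v ∈ t, Q v) ≠ 0 := by
    rw [Finset.prod_ne_zero_iff]
    intro v hv h0
    exact hQc v (ht v hv) 0 (by simpa using h0)
  have hNC : toC N = MvPolynomial.X (k0, false) * MvPolynomial.X (k0, true) := by
    have e1 : (MvPolynomial.C (1 / 2) : MvPolynomial (Fin n × Bool) ℂ) ^ 2 = MvPolynomial.C (1/4) := by
      rw [← map_pow]; norm_num
    have e2 : (MvPolynomial.C (-Complex.I / 2) : MvPolynomial (Fin n × Bool) ℂ) ^ 2
        = - MvPolynomial.C (1/4) := by
      rw [← map_pow, ← map_neg]; congr 1; rw [div_pow, neg_sq, Complex.I_sq]; norm_num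
    have e3 : (MvPolynomial.C (1/4) : MvPolynomial (Fin n × Bool) ℂ) * 4 = 1 := by
      rw [show (4 : MvPolynomial (Fin n × Bool) ℂ) = MvPolynomial.C 4 from (map_ofNat _ 4).symm,
        ← map_mul]; norm_num
    simp only [toC, N, map_add, map_pow, MvPolynomial.aeval_X, if_true, mul_pow, e1, e2,
      Bool.false_eq_true, if_false]
    linear_combination (MvPolynomial.X (k0, false) * MvPolynomial.X (k0, true)) * e3
  have hvan : ∀ w ∈ susp F, realEval P w = 0 := by
    rintro w ⟨z, hz, v, hv, rfl⟩
    obtain ⟨u, hu, hvu⟩ := mem_iUnion₂.1 (hcov (subset_closure hv))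
    have := hQ u (ht u hu) (z • v) ⟨z, hz, v, ⟨hvu, subset_closure hv⟩, rfl⟩
    simp only [realEval, P, map_mul, map_prod] at this ⊢
    rw [Finset.prod_eq_zero hu this, zero_mul]
  have hPsm : SmoothAtOrigin (fun z => ((realEval P z : ℝ) : ℂ)) := by
    intro k _
    rw [cEval_toC]
    exact ⟨univ, isOpen_univ, mem_univ _, (contDiff_cEval k _).contDiffOn⟩
  have hhol : ∀ v ∈ F, DifferentiableOn ℂ (fun z : ℂ => ((realEval P (z • v) : ℝ) : ℂ))
        (Metric.ball (0 : ℂ) 1) := by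
    intro v hv
    apply (differentiableOn_const (0 : ℂ)).congr
    intro z hz
    simp [hvan (z • v) ⟨z, hz, v, hv, rfl⟩]
  have hmix : ∃ I J : Fin n → ℕ, J ≠ 0 ∧
      mixedCoeff (fun z => ((realEval P z : ℝ) : ℂ)) I J ≠ 0 := by
    have hT : toC (∏ v ∈ t, Q v) ≠ 0 := by
      obtain ⟨z, hz⟩ := exists_realEval_ne _ hQ0
      intro h
      have := congrFun (cEval_toC (∏ v ∈ t, Q v)) z
      rw [h] at this
      apply hz
      simpa [cEval] using this
    obtain ⟨m, hm⟩ := MvPolynomial.ne_zero_iff.1 hT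
    have hPm : (toC P).coeff (m + Finsupp.single (k0, false) 1 + Finsupp.single (k0, true) 1) ≠ 0 := by
      have : toC P = toC (∏ v ∈ t, Q v) * MvPolynomial.X (k0, false) * MvPolynomial.X (k0, true) := by
        rw [mul_assoc, ← hNC]; simp only [toC, P, map_mul]
      rw [this, MvPolynomial.coeff_mul_X, MvPolynomial.coeff_mul_X]
      exact hm
    refine ⟨_, _, ?_, by rw [cEval_toC]; exact mixedCoeff_cEval _ _ hPm⟩
    intro h
    have := congrFun h k0
    simp at this
  refine ⟨P, ?_, hvan, hPsm, hhol, hmix, ?_⟩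
  · intro c hc
    obtain ⟨v, hv⟩ := hFne
    have h1 : realEval P 0 = 0 := hvan 0 ⟨0, by simp, v, hv, by simp⟩
    have hc0 : c = 0 := by simpa [hc, realEval] using h1
    have hN : N ≠ 0 := by
      intro h
      rw [h] at hNC
      have : (MvPolynomial.X (k0, false) * MvPolynomial.X (k0, true) : MvPolynomial (Fin n × Bool) ℂ) ≠ 0 :=
        mul_ne_zero (MvPolynomial.X_ne_zero _) (MvPolynomial.X_ne_zero _)
      exact this (by rw [← hNC]; simp [toC])
    exact mul_ne_zero hQ0 hN (by rw [show (∏ v ∈ t, Q v) * N = P from rfl, hc, hc0, map_zero])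
  · intro h
    obtain ⟨I, J, hJ, hne⟩ := hmix
    exact hne (h _ hPsm hhol I J hJ)


end
end

section
/- Let n ≥ 1, let f be a ℂ-valued function defined near 0 ∈ ℂⁿ with f ∈ C^∞(0), and let v ∈ S^{2n−1} be such that z ↦ f(zv) is holomorphic on a disc around 0 in ℂ. Then for all integers p ≥ 0 and q ≥ 1, Σ_{|I|=p, |J|=q} C_I^J v^I v̄^J = 0, where C_I^J = (1/(I!J!)) ∂^{|I|+|J|} f/∂z^I ∂z̄^J (0). -/
open MeasureTheory Filter Metric Set
open scoped ENNReal

noncomputable section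

lemma sum_adT_succ {R : Type*} [AddCommMonoid R] (n p : ℕ) (g : (Fin (n + 1) → ℕ) → R) :
    ∑ I ∈ Finset.Nat.antidiagonalTuple (n + 1) p, g I =
      ∑ m ∈ Finset.HasAntidiagonal.antidiagonal p, ∑ I ∈ Finset.Nat.antidiagonalTuple n m.2,
        g (Fin.cons m.1 I) := by
  rw [Finset.sum_sigma']
  refine Finset.sum_bij' (fun I _ => ⟨(I 0, ∑ i, Fin.tail I i), Fin.tail I⟩)
    (fun s _ => Fin.cons s.1.1 s.2) ?_ ?_ ?_ ?_ ?_
  · intro I hI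
    rw [Finset.Nat.mem_antidiagonalTuple, Fin.sum_univ_succ] at hI
    simpa [Finset.Nat.mem_antidiagonalTuple, Fin.tail] using hI
  · rintro ⟨⟨a, b⟩, I⟩ hI
    simp only [Finset.mem_sigma, Finset.HasAntidiagonal.mem_antidiagonal, Finset.Nat.mem_antidiagonalTuple] at hI
    simp [Finset.Nat.mem_antidiagonalTuple, Fin.sum_univ_succ, hI.1, hI.2]
  · intro I hI
    simp
  · rintro ⟨⟨a, b⟩, I⟩ hI
    simp only [Finset.mem_sigma, Finset.HasAntidiagonal.mem_antidiagonal, Finset.Nat.mem_antidiagonalTuple] at hI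
    obtain ⟨h1, rfl⟩ := hI
    simp
  · intro I hI
    simp

lemma multinom_aux {R : Type*} [Ring R] [Algebra ℂ R] : ∀ (n : ℕ) (x : Fin n → R) (c : Fin n → ℂ)
    (hx : ∀ i j, Commute (x i) (x j)) (p : ℕ),
    ((p.factorial : ℂ)⁻¹) • (∑ i, c i • x i) ^ p =
      ∑ I ∈ Finset.Nat.antidiagonalTuple n p,
        (((∏ i, (I i).factorial : ℕ) : ℂ)⁻¹ * ∏ i, c i ^ I i) •
          ((List.finRange n).map (fun i => x i ^ I i)).prod := by
  intro n
  induction n with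
  | zero =>
    intro x c hx p
    rcases p with _ | p <;> simp
  | succ n ih =>
    intro x c hx p
    have hc : Commute (c 0 • x 0) (∑ i : Fin n, c i.succ • x i.succ) := by
      refine Commute.sum_right _ _ _ fun i _ => ?_
      exact ((hx _ _).smul_right _).smul_left _
    rw [Fin.sum_univ_succ, hc.add_pow', sum_adT_succ, Finset.smul_sum]
    refine Finset.sum_congr rfl fun m hm => ?_
    have hm' : m.1 + m.2 = p := by simpa using hm
    have e1 : ((p.factorial : ℂ)⁻¹) * (p.choose m.1 : ℂ)
        = (m.1.factorial : ℂ)⁻¹ * (m.2.factorial : ℂ)⁻¹ := by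
      have h := Nat.add_choose_mul_factorial_mul_factorial m.1 m.2
      rw [hm', ← Nat.choose_symm_of_eq_add hm'.symm] at h
      have h' : (p.choose m.1 : ℂ) * m.1.factorial * m.2.factorial = p.factorial := by
        exact_mod_cast h
      have a1 : (m.1.factorial : ℂ) ≠ 0 := by exact_mod_cast m.1.factorial_ne_zero
      have a2 : (m.2.factorial : ℂ) ≠ 0 := by exact_mod_cast m.2.factorial_ne_zero
      have a3 : (p.factorial : ℂ) ≠ 0 := by exact_mod_cast p.factorial_ne_zero
      field_simp
      linear_combination h'
    have e2 := ih (fun i => x i.succ) (fun i => c i.succ) (fun i j => hx _ _) m.2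
    rw [← Nat.cast_smul_eq_nsmul ℂ, smul_smul, e1, mul_smul, ← mul_smul_comm, e2, smul_pow,
      Finset.mul_sum, Finset.smul_sum]
    refine Finset.sum_congr rfl fun I _ => ?_
    simp only [List.finRange_succ, List.map_cons, List.map_map, List.prod_cons, Fin.prod_univ_succ,
      Fin.cons_zero, Fin.cons_succ, Function.comp_def]
    rw [smul_mul_smul_comm, smul_smul]
    congr 1
    push_cast
    rw [mul_inv]
    ring

/-- smooth functions -/
def Sm (n : ℕ) : Submodule ℂ (EuclideanSpace ℂ (Fin n) → ℂ) where
  carrier := {f | ContDiffAt ℝ (⊤ : ℕ∞) f 0}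
  add_mem' := by
    intro a b ha hb
    have ha' : ContDiffAt ℝ (⊤ : ℕ∞) a 0 := ha
    have hb' : ContDiffAt ℝ (⊤ : ℕ∞) b 0 := hb
    exact ha'.add hb'
  zero_mem' := by
    change ContDiffAt ℝ (⊤ : ℕ∞) (fun _ => (0 : ℂ)) 0
    exact contDiffAt_const
  smul_mem' := by
    intro c f hf
    have hf' : ContDiffAt ℝ (⊤ : ℕ∞) f 0 := hf
    exact hf'.const_smul c

lemma sm_cd {n : ℕ} (f : Sm n) : ContDiffAt ℝ (⊤ : ℕ∞) f.1 0 := f.2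

/-- smooth functions vanishing near zero -/
def Nul (n : ℕ) : Submodule ℂ (Sm n) where
  carrier := {f | ∀ᶠ z in nhds 0, f.1 z = 0}
  add_mem' ha hb := by
    filter_upwards [ha, hb] with z h1 h2
    simp [h1, h2]
  zero_mem' := by simp
  smul_mem' c f hf := by
    filter_upwards [hf] with z h1
    simp [h1]

lemma sm_diff {n : ℕ} (f : Sm n) : ∀ᶠ z in nhds 0, DifferentiableAt ℝ f.1 z := by
  have h : ContDiffAt ℝ 1 f.1 0 := ContDiffAt.of_le (sm_cd f) (by exact_mod_cast le_top)
  filter_upwards [h.eventually (by simp)] with z hz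
  exact hz.differentiableAt (by simp)

lemma sm_fd {n : ℕ} (f : Sm n) : ContDiffAt ℝ (⊤ : ℕ∞) (fderiv ℝ f.1) 0 :=
  ContDiffAt.fderiv_right (sm_cd f) (by simp)

/-- directional derivative -/
def dS {n : ℕ} (e : EuclideanSpace ℂ (Fin n)) (f : Sm n) : Sm n :=
  ⟨fun z => fderiv ℝ f.1 z e, ContDiffAt.clm_apply (sm_fd f) contDiffAt_const⟩

abbrev Qt (n : ℕ) := Sm n ⧸ Nul n

lemma Qt.mk_eq {n : ℕ} (f g : Sm n) :
    (Nul n).mkQ f = (Nul n).mkQ g ↔ ∀ᶠ z in nhds 0, f.1 z = g.1 z := by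
  rw [← sub_eq_zero, ← map_sub]
  simp only [Submodule.mkQ_apply, Submodule.Quotient.mk_eq_zero]
  change (∀ᶠ z in nhds 0, f.1 z - g.1 z = 0) ↔ _
  simp [sub_eq_zero]

def dQ {n : ℕ} (e : EuclideanSpace ℂ (Fin n)) : Module.End ℂ (Qt n) :=
  (Nul n).liftQ
    { toFun := fun f => (Nul n).mkQ (dS e f)
      map_add' := by
        intro f g
        rw [← map_add, Qt.mk_eq]
        filter_upwards [(sm_diff f), (sm_diff g)] with z h1 h2
        simp [dS, fderiv_add h1 h2]
      map_smul' := by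
        intro c f
        simp only [RingHom.id_apply]
        rw [← map_smul, Qt.mk_eq]
        filter_upwards [(sm_diff f)] with z h1
        simp [dS, fderiv_const_smul h1 c] }
    (by
      intro f hf
      have h0 : (0 : Qt n) = (Nul n).mkQ 0 := by simp
      simp only [LinearMap.mem_ker, LinearMap.coe_mk, AddHom.coe_mk]
      rw [h0, Qt.mk_eq]
      have hf' : f.1 =ᶠ[nhds 0] fun _ => (0 : ℂ) := hf
      filter_upwards [hf'.fderiv (𝕜 := ℝ)] with z hz
      simp [dS, hz])

lemma dQ_mk {n : ℕ} (e : EuclideanSpace ℂ (Fin n)) (f : Sm n) :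
    dQ e ((Nul n).mkQ f) = (Nul n).mkQ (dS e f) := rfl

lemma dQ_comm {n : ℕ} (e e' : EuclideanSpace ℂ (Fin n)) : Commute (dQ e) (dQ e') := by
  refine LinearMap.ext fun x => ?_
  obtain ⟨f, rfl⟩ := (Nul n).mkQ_surjective x
  simp only [Module.End.mul_apply, dQ_mk]
  rw [Qt.mk_eq]
  have h : ContDiffAt ℝ 2 f.1 0 := contDiffAt_infty.1 (sm_cd f) 2
  have h1 : ContDiffAt ℝ 1 (fderiv ℝ f.1) 0 := ContDiffAt.of_le (sm_fd f) (by exact_mod_cast le_top)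
  filter_upwards [h.eventually (by simp), h1.eventually (by simp)] with z hz hz1
  have hs := hz.isSymmSndFDerivAt (by simp)
  have hd := hz1.differentiableAt (by simp)
  simp only [dS]
  rw [fderiv_clm_apply hd (by fun_prop), fderiv_clm_apply hd (by fun_prop)]
  simpa using hs e e'

lemma dQ_add {n : ℕ} (e e' : EuclideanSpace ℂ (Fin n)) : dQ (e + e') = dQ e + dQ e' := by
  refine LinearMap.ext fun x => ?_
  obtain ⟨f, rfl⟩ := (Nul n).mkQ_surjective x
  simp only [LinearMap.add_apply, dQ_mk]
  rw [← map_add, Qt.mk_eq]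
  simp [dS]

lemma dQ_smul {n : ℕ} (r : ℝ) (e : EuclideanSpace ℂ (Fin n)) : dQ (r • e) = (r : ℂ) • dQ e := by
  refine LinearMap.ext fun x => ?_
  obtain ⟨f, rfl⟩ := (Nul n).mkQ_surjective x
  simp only [LinearMap.smul_apply, dQ_mk]
  rw [← map_smul, Qt.mk_eq]
  simp [dS]

def qA {n : ℕ} (k : Fin n) : Module.End ℂ (Qt n) :=
  (2 : ℂ)⁻¹ • (dQ (EuclideanSpace.single k 1) - Complex.I • dQ (EuclideanSpace.single k Complex.I))

def qB {n : ℕ} (k : Fin n) : Module.End ℂ (Qt n) :=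
  (2 : ℂ)⁻¹ • (dQ (EuclideanSpace.single k 1) + Complex.I • dQ (EuclideanSpace.single k Complex.I))

lemma qA_comm {n : ℕ} (k l : Fin n) : Commute (qA k) (qA l) := by
  unfold qA
  refine Commute.smul_left (Commute.smul_right ?_ _) _
  refine Commute.sub_left (Commute.sub_right ?_ ?_) (Commute.sub_right ?_ ?_)
  · exact dQ_comm _ _
  · exact (dQ_comm _ _).smul_right _
  · exact (dQ_comm _ _).smul_left _
  · exact ((dQ_comm _ _).smul_right _).smul_left _

lemma qB_comm {n : ℕ} (k l : Fin n) : Commute (qB k) (qB l) := by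
  unfold qB
  refine Commute.smul_left (Commute.smul_right ?_ _) _
  refine Commute.add_left (Commute.add_right ?_ ?_) (Commute.add_right ?_ ?_)
  · exact dQ_comm _ _
  · exact (dQ_comm _ _).smul_right _
  · exact (dQ_comm _ _).smul_left _
  · exact ((dQ_comm _ _).smul_right _).smul_left _

lemma dQ_expand {n : ℕ} (v : EuclideanSpace ℂ (Fin n)) :
    dQ v = ∑ k, (((v k).re : ℂ) • dQ (EuclideanSpace.single k 1)
      + ((v k).im : ℂ) • dQ (EuclideanSpace.single k Complex.I)) := by
  let φ : EuclideanSpace ℂ (Fin n) →+ Module.End ℂ (Qt n) := AddMonoidHom.mk' dQ dQ_add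
  have hv : v = ∑ k, ((v k).re • EuclideanSpace.single k (1 : ℂ)
      + (v k).im • EuclideanSpace.single k Complex.I) := by
    ext j
    simp [Finset.sum_add_distrib, Pi.single_apply, Complex.re_add_im]
  have : φ v = _ := congrArg φ hv
  rw [map_sum] at this
  refine this.trans (Finset.sum_congr rfl fun k _ => ?_)
  rw [map_add]
  exact congrArg₂ (· + ·) (dQ_smul _ _) (dQ_smul _ _)

lemma sum_qA {n : ℕ} (v : EuclideanSpace ℂ (Fin n)) :
    ∑ k, v k • qA k = (2 : ℂ)⁻¹ • (dQ v - Complex.I • dQ (Complex.I • v)) := by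
  rw [dQ_expand v, dQ_expand (Complex.I • v), Finset.smul_sum, ← Finset.sum_sub_distrib,
    Finset.smul_sum]
  refine Finset.sum_congr rfl fun k _ => ?_
  unfold qA
  conv_lhs => rw [← Complex.re_add_im (v k)]
  simp only [PiLp.smul_apply, smul_eq_mul, Complex.mul_re, Complex.mul_im, Complex.I_re,
    Complex.I_im]
  push_cast
  match_scalars <;> ring_nf <;> simp <;> ring

lemma sum_qB {n : ℕ} (v : EuclideanSpace ℂ (Fin n)) :
    ∑ k, (starRingEnd ℂ) (v k) • qB k
      = (2 : ℂ)⁻¹ • (dQ v + Complex.I • dQ (Complex.I • v)) := by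
  rw [dQ_expand v, dQ_expand (Complex.I • v), Finset.smul_sum, ← Finset.sum_add_distrib,
    Finset.smul_sum]
  refine Finset.sum_congr rfl fun k _ => ?_
  unfold qB
  have : (starRingEnd ℂ) (v k) = (v k).re - (v k).im * Complex.I := by
    apply Complex.ext <;> simp
  rw [this]
  simp only [PiLp.smul_apply, smul_eq_mul, Complex.mul_re, Complex.mul_im, Complex.I_re,
    Complex.I_im]
  push_cast
  match_scalars <;> ring_nf <;> simp <;> ring

/-- `x` is the class of `g`. -/
def RepQ {n : ℕ} (g : EuclideanSpace ℂ (Fin n) → ℂ) (x : Qt n) : Prop :=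
  ∃ f : Sm n, f.1 = g ∧ (Nul n).mkQ f = x

lemma RepQ.wDz {n : ℕ} {g : EuclideanSpace ℂ (Fin n) → ℂ} {x : Qt n} (h : RepQ g x) (k : Fin n) :
    RepQ (wDz k g) (qA k x) := by
  obtain ⟨f, rfl, rfl⟩ := h
  exact ⟨(2 : ℂ)⁻¹ • (dS (EuclideanSpace.single k 1) f
    - Complex.I • dS (EuclideanSpace.single k Complex.I) f), rfl, rfl⟩

lemma RepQ.wDzbar {n : ℕ} {g : EuclideanSpace ℂ (Fin n) → ℂ} {x : Qt n} (h : RepQ g x) (k : Fin n) :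
    RepQ (wDzbar k g) (qB k x) := by
  obtain ⟨f, rfl, rfl⟩ := h
  exact ⟨(2 : ℂ)⁻¹ • (dS (EuclideanSpace.single k 1) f
    + Complex.I • dS (EuclideanSpace.single k Complex.I) f), rfl, rfl⟩

lemma RepQ.fold {n : ℕ} {g : EuclideanSpace ℂ (Fin n) → ℂ} {x : Qt n} (h : RepQ g x)
    (T : Fin n → (EuclideanSpace ℂ (Fin n) → ℂ) → (EuclideanSpace ℂ (Fin n) → ℂ))
    (A : Fin n → Module.End ℂ (Qt n))
    (hT : ∀ k g x, RepQ g x → RepQ (T k g) (A k x)) (I : Fin n → ℕ) (l : List (Fin n)) :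
    RepQ (List.foldr (fun k g => (T k)^[I k] g) g l) ((l.map (fun k => A k ^ I k)).prod x) := by
  induction l with
  | nil => simpa using h
  | cons k l ih =>
    simp only [List.foldr_cons, List.map_cons, List.prod_cons, Module.End.mul_apply]
    generalize I k = m
    induction m with
    | zero => simpa using ih
    | succ m ihm =>
      rw [Function.iterate_succ_apply', pow_succ', Module.End.mul_apply]
      exact hT _ _ _ ihm

def ev0 {n : ℕ} : Qt n →ₗ[ℂ] ℂ :=
  (Nul n).liftQ
    { toFun := fun f => f.1 0
      map_add' := fun _ _ => rfl
      map_smul' := fun _ _ => rfl }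
    (fun f hf => by
      have hf' : ∀ᶠ z in nhds 0, f.1 z = 0 := hf
      exact hf'.self_of_nhds)

lemma RepQ.ev {n : ℕ} {g : EuclideanSpace ℂ (Fin n) → ℂ} {x : Qt n} (h : RepQ g x) :
    ev0 x = g 0 := by
  obtain ⟨f, rfl, rfl⟩ := h
  rfl

/-- `x` vanishes on the complex line through `v`. -/
def Van {n : ℕ} (v : EuclideanSpace ℂ (Fin n)) : Submodule ℂ (Qt n) :=
  Submodule.map (Nul n).mkQ
    { carrier := {f : Sm n | ∀ᶠ z : ℂ in nhds 0, f.1 (z • v) = 0}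
      add_mem' := by
        intro a b ha hb
        filter_upwards [ha, hb] with z h1 h2
        simp [h1, h2]
      zero_mem' := by simp
      smul_mem' := by
        intro c f hf
        filter_upwards [hf] with z h1
        simp [h1] }

lemma tend {n : ℕ} (v : EuclideanSpace ℂ (Fin n)) :
    Tendsto (fun z : ℂ => z • v) (nhds 0) (nhds 0) := by
  have : Continuous (fun z : ℂ => z • v) := by fun_prop
  simpa using this.tendsto 0

lemma line_deriv {n : ℕ} (v : EuclideanSpace ℂ (Fin n)) (f : Sm n) :
    ∀ᶠ z : ℂ in nhds 0, ∀ w : ℂ,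
      fderiv ℝ f.1 (z • v) (w • v) = fderiv ℝ (fun z : ℂ => f.1 (z • v)) z w := by
  filter_upwards [(tend v).eventually (sm_diff f)] with z hz w
  have h1 : HasFDerivAt (fun z : ℂ => z • v)
      ((ContinuousLinearMap.toSpanSingleton ℂ v).restrictScalars ℝ) z :=
    ((ContinuousLinearMap.toSpanSingleton ℂ v).restrictScalars ℝ).hasFDerivAt
  have h2 := hz.hasFDerivAt.comp z h1
  have h3 : fderiv ℝ (fun z : ℂ => f.1 (z • v)) z = _ := h2.fderiv
  rw [h3]
  simp

lemma Van.dQ {n : ℕ} {v : EuclideanSpace ℂ (Fin n)} {x : Qt n} (hx : x ∈ Van v) (w : ℂ) :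
    dQ (w • v) x ∈ Van v := by
  obtain ⟨f, hf, rfl⟩ := hx
  refine ⟨dS (w • v) f, ?_, rfl⟩
  have hf' : (fun z : ℂ => f.1 (z • v)) =ᶠ[nhds 0] fun _ => (0 : ℂ) := hf
  change ∀ᶠ z : ℂ in nhds 0, fderiv ℝ f.1 (z • v) (w • v) = 0
  filter_upwards [line_deriv v f, hf'.fderiv (𝕜 := ℝ)] with z h1 h2
  rw [h1 w, h2]
  simp

lemma Van.ev {n : ℕ} {v : EuclideanSpace ℂ (Fin n)} {x : Qt n} (hx : x ∈ Van v) :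
    ev0 x = 0 := by
  obtain ⟨f, hf, rfl⟩ := hx
  have hf' : ∀ᶠ z : ℂ in nhds 0, f.1 (z • v) = 0 := hf
  have := hf'.self_of_nhds
  rw [zero_smul] at this
  exact this

lemma Van.hol {n : ℕ} {v : EuclideanSpace ℂ (Fin n)} (f : Sm n)
    (δ : ℝ) (hδ : 0 < δ)
    (hhol : DifferentiableOn ℂ (fun z : ℂ => f.1 (z • v)) (Metric.ball (0 : ℂ) δ)) :
    (∑ k, (starRingEnd ℂ) (v k) • qB k) ((Nul n).mkQ f) ∈ Van v := by
  rw [sum_qB]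
  refine ⟨(2 : ℂ)⁻¹ • (dS v f + Complex.I • dS (Complex.I • v) f), ?_, rfl⟩
  change ∀ᶠ z : ℂ in nhds 0, (2 : ℂ)⁻¹ • (fderiv ℝ f.1 (z • v) v +
    Complex.I • fderiv ℝ f.1 (z • v) (Complex.I • v)) = 0
  filter_upwards [line_deriv v f, Metric.ball_mem_nhds (0 : ℂ) hδ] with z h1 h2
  have h3 := (hhol.differentiableAt (Metric.isOpen_ball.mem_nhds h2)).hasDerivAt
  have h4 := (h3.hasFDerivAt.restrictScalars ℝ).fderiv
  have e1 := h1 1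
  have e2 := h1 Complex.I
  rw [one_smul] at e1
  rw [e1, e2, h4]
  simp [← mul_assoc]

/-- If `f` is smooth at the origin and `z ↦ f(zv)` is holomorphic on a disc around `0` for
a unit vector `v`, then `Σ_{|I|=p, |J|=q} C_I^J v^I v̄^J = 0` for all `p ≥ 0` and `q ≥ 1`. -/
theorem leafwise_holomorphic_coeff_vanishing {n : ℕ} (hn : 1 ≤ n)
    (f : EuclideanSpace ℂ (Fin n) → ℂ) (hf : SmoothAtOrigin f)
    (v : EuclideanSpace ℂ (Fin n)) (hv : ‖v‖ = 1)
    (δ : ℝ) (hδ : 0 < δ)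
    (hhol : DifferentiableOn ℂ (fun z : ℂ => f (z • v)) (Metric.ball (0 : ℂ) δ)) :
    ∀ p q : ℕ, 1 ≤ q →
      ∑ I ∈ Finset.Nat.antidiagonalTuple n p, ∑ J ∈ Finset.Nat.antidiagonalTuple n q,
        mixedCoeff f I J * (∏ i, v i ^ I i) * ∏ i, (starRingEnd ℂ) (v i) ^ J i = 0 := by
  intro p q hq
  have hfs : ContDiffAt ℝ (⊤ : ℕ∞) f 0 := by
    rw [contDiffAt_infty]
    intro k
    obtain ⟨V, hV, h0, hc⟩ := hf (k + 1) (Nat.succ_pos k)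
    exact (hc.contDiffAt (hV.mem_nhds h0)).of_le (by exact_mod_cast Nat.le_succ k)
  let F : Sm n := ⟨f, hfs⟩
  set x : Qt n := (Nul n).mkQ F with hx
  have hR : RepQ f x := ⟨F, rfl, rfl⟩
  set L : Module.End ℂ (Qt n) := ∑ k, v k • qA k with hL
  set M : Module.End ℂ (Qt n) := ∑ k, (starRingEnd ℂ) (v k) • qB k with hM
  have hd1 : ∀ y ∈ Van v, dQ v y ∈ Van v := fun y hy => by
    simpa using Van.dQ hy 1
  have hLV : ∀ y ∈ Van v, L y ∈ Van v := by
    intro y hy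
    rw [hL, sum_qA]
    exact (Van v).smul_mem _ ((Van v).sub_mem (hd1 y hy) ((Van v).smul_mem _ (Van.dQ hy _)))
  have hMV : ∀ y ∈ Van v, M y ∈ Van v := by
    intro y hy
    rw [hM, sum_qB]
    exact (Van v).smul_mem _ ((Van v).add_mem (hd1 y hy) ((Van v).smul_mem _ (Van.dQ hy _)))
  have hMx : M x ∈ Van v := Van.hol F δ hδ hhol
  have hMq : (M ^ q) x ∈ Van v := by
    obtain ⟨m, rfl⟩ : ∃ m, q = m + 1 := ⟨q - 1, by omega⟩
    clear hq
    induction m with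
    | zero => simpa using hMx
    | succ m ih =>
      rw [pow_succ', Module.End.mul_apply]
      exact hMV _ ih
  have hLp : (L ^ p) ((M ^ q) x) ∈ Van v := by
    induction p with
    | zero => simpa using hMq
    | succ m ih =>
      rw [pow_succ', Module.End.mul_apply]
      exact hLV _ ih
  have key : ev0 ((((p.factorial : ℂ)⁻¹) • L ^ p) ((((q.factorial : ℂ)⁻¹) • M ^ q) x)) = 0 := by
    simp only [LinearMap.smul_apply, map_smul, Van.ev hLp, smul_zero]
  rw [hL, hM, multinom_aux n _ _ qA_comm, multinom_aux n _ _ qB_comm] at key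
  simp only [LinearMap.sum_apply, map_sum, LinearMap.smul_apply, map_smul, smul_eq_mul] at key
  rw [← key]
  rw [Finset.sum_comm]
  refine Finset.sum_congr rfl fun J _ => ?_
  rw [Finset.mul_sum]
  refine Finset.sum_congr rfl fun I _ => ?_
  have hr := ((hR.fold wDzbar qB (fun k g x h => h.wDzbar k) J (List.finRange n)).fold wDz qA
    (fun k g x h => h.wDz k) I (List.finRange n)).ev
  rw [hr]
  simp only [mixedCoeff, wDzIter, wDzbarIter, Nat.cast_mul, mul_inv]
  ring

end
end

section
/- Let n ≥ 2 and let F ⊆ S^{2n−1} be nonempty. If the direction set F' ⊆ ℂ^{n−1} is not pluripolar (equivalently, its logarithmic capacity c_{n−1}(F') is nonzero), then the suspension S₀(F) is normal: every formal power series S ∈ ℂ[[z₁,…,zₙ]] such that, for each v ∈ F, the one-variable formal series S_v(t) = S(tv) has a positive radius of convergence, converges uniformly on some neighborhood of the origin in ℂⁿ. -/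
open MeasureTheory Filter Metric Set
open scoped ENNReal

noncomputable section

/-- The nonnegative part of an extended real, as an element of `ℝ≥0∞`. -/
def erealToENNReal (x : EReal) : ℝ≥0∞ :=
  if x = ⊤ then ⊤ else ENNReal.ofReal x.toReal

/-- Integral of an `EReal`-valued function: the integral of the positive part minus
the integral of the negative part (both computed as lower integrals). -/
def erealIntegral {α : Type*} [MeasurableSpace α] (μ : Measure α) (g : α → EReal) : EReal :=
  ((∫⁻ x, erealToENNReal (g x) ∂μ : ℝ≥0∞) : EReal)
    - ((∫⁻ x, erealToENNReal (-(g x)) ∂μ : ℝ≥0∞) : EReal)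

/-- The mean of an `EReal`-valued function over the circle of radius `r` centered at `a`
along the complex line through `a` with direction `b`. -/
def circleLineMean {E : Type*} [AddCommGroup E] [Module ℂ E]
    (u : E → EReal) (a b : E) (r : ℝ) : EReal :=
  (((2 * Real.pi)⁻¹ : ℝ) : EReal) *
    erealIntegral (volume.restrict (Set.Ioc (0:ℝ) (2 * Real.pi)))
      (fun θ : ℝ => u (a + (r * Complex.exp (θ * Complex.I)) • b))

/-- `u : ℂᵐ → [-∞,∞)` is plurisubharmonic: upper semicontinuous, not identically `-∞`,
never `+∞`, and satisfying the sub-mean value inequality over circles on every complex line. -/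
def IsPSH {m : ℕ} (u : EuclideanSpace ℂ (Fin m) → EReal) : Prop :=
  UpperSemicontinuous u ∧ (∃ z, u z ≠ ⊥) ∧ (∀ z, u z ≠ ⊤) ∧
    ∀ (a b : EuclideanSpace ℂ (Fin m)) (r : ℝ), 0 < r → u a ≤ circleLineMean u a b r

/-- A set `E ⊆ ℂᵐ` is pluripolar if it is contained in the `-∞` set of some
plurisubharmonic function. -/
def Pluripolar {m : ℕ} (E : Set (EuclideanSpace ℂ (Fin m))) : Prop :=
  ∃ u, IsPSH u ∧ ∀ z ∈ E, u z = ⊥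

/-- The Lelong class `L_m` of plurisubharmonic functions of logarithmic growth. -/
def LelongClass (m : ℕ) : Set (EuclideanSpace ℂ (Fin m) → EReal) :=
  {u | IsPSH u ∧ ∃ C : ℝ, ∀ z, u z ≤ ((C + Real.log (1 + ‖z‖) : ℝ) : EReal)}

/-- The Siciak extremal function `V_E`. -/
def extremalFn {m : ℕ} (E : Set (EuclideanSpace ℂ (Fin m))) (z : EuclideanSpace ℂ (Fin m)) :
    EReal :=
  sSup {x : EReal | ∃ u ∈ LelongClass m, (∀ w ∈ E, u w ≤ 0) ∧ x = u z}

/-- The upper regularization `V*_E(a) = limsup_{w → a} V_E(w)`. -/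
def extremalFnStar {m : ℕ} (E : Set (EuclideanSpace ℂ (Fin m)))
    (a : EuclideanSpace ℂ (Fin m)) : EReal :=
  Filter.limsup (extremalFn E) (nhds a)

/-- `E` is L-regular at `a`. -/
def LRegularAt {m : ℕ} (E : Set (EuclideanSpace ℂ (Fin m)))
    (a : EuclideanSpace ℂ (Fin m)) : Prop :=
  extremalFnStar E a = 0

/-- `E` is locally L-regular at `a`. -/
def LocallyLRegularAt {m : ℕ} (E : Set (EuclideanSpace ℂ (Fin m)))
    (a : EuclideanSpace ℂ (Fin m)) : Prop :=
  ∀ r : ℝ, 0 < r → LRegularAt (E ∩ Metric.ball a r) a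

/-- The `i`-th direction set `F'_i ⊆ ℂ^{n-1}`. -/
def dirSetI {m : ℕ} (F : Set (EuclideanSpace ℂ (Fin (m + 1)))) (i : Fin (m + 1)) :
    Set (EuclideanSpace ℂ (Fin m)) :=
  {w | ∃ z ∈ F, z i ≠ 0 ∧ ∀ j : Fin m, w j = z (i.succAbove j) / z i}

/-- The direction set `F' = ∪ᵢ F'_i`. -/
def dirSet {m : ℕ} (F : Set (EuclideanSpace ℂ (Fin (m + 1)))) :
    Set (EuclideanSpace ℂ (Fin m)) :=
  ⋃ i, dirSetI F i

/-- `v ∈ F̄` generates a regular leaf of `S₀(F)`. -/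
def GeneratesRegularLeaf {m : ℕ} (F : Set (EuclideanSpace ℂ (Fin (m + 1))))
    (v : EuclideanSpace ℂ (Fin (m + 1))) : Prop :=
  v ∈ closure F ∧ ∃ i : Fin (m + 1), v i ≠ 0 ∧
    LocallyLRegularAt (dirSetI F i)
      (WithLp.toLp 2 (fun j : Fin m => v (i.succAbove j) / v i : Fin m → ℂ) :
        EuclideanSpace ℂ (Fin m))

/-- The coefficients of the one-variable restriction `t ↦ S(tv)` of a formal power series. -/
def lineCoeff {n : ℕ} (S : MvPowerSeries (Fin n) ℂ) (v : EuclideanSpace ℂ (Fin n)) (k : ℕ) :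
    ℂ :=
  ∑ I ∈ Finset.Nat.antidiagonalTuple n k,
    MvPowerSeries.coeff (Finsupp.equivFunOnFinite.symm I) S * ∏ i, v i ^ I i

/-- A one-variable power series (given by its coefficients) has a positive radius of
convergence. -/
def HasPosRadius (c : ℕ → ℂ) : Prop :=
  ∃ r : ℝ, 0 < r ∧ Summable fun k => ‖c k‖ * r ^ k

/-- The degree-wise partial sums of a formal power series in `n` variables. -/
def partialSum {n : ℕ} (S : MvPowerSeries (Fin n) ℂ) (N : ℕ) (z : EuclideanSpace ℂ (Fin n)) :
    ℂ :=
  ∑ k ∈ Finset.range N, ∑ I ∈ Finset.Nat.antidiagonalTuple n k,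
    MvPowerSeries.coeff (Finsupp.equivFunOnFinite.symm I) S * ∏ i, z i ^ I i

/-- `S` converges uniformly on some neighborhood of the origin. -/
def ConvUnifNearZero {n : ℕ} (S : MvPowerSeries (Fin n) ℂ) : Prop :=
  ∃ r : ℝ, 0 < r ∧ ∃ g : EuclideanSpace ℂ (Fin n) → ℂ,
    TendstoUniformlyOn (partialSum S) g Filter.atTop
      (Metric.ball (0 : EuclideanSpace ℂ (Fin n)) r)


/-- `C - log ‖z‖ / k`, as an extended nonnegative real. -/
noncomputable def negLogK (k : ℕ) (z : ℂ) (C : ℝ) : ℝ≥0∞ :=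
  if z = 0 then ⊤ else ENNReal.ofReal (C - Real.log ‖z‖ / k)

theorem negLogK_eq_iSup (k : ℕ) (hk : 1 ≤ k) (z : ℂ) (C : ℝ) :
    negLogK k z C = ⨆ N : ℕ, ENNReal.ofReal (C - Real.log (max ‖z‖ (Real.exp (-(N:ℝ)))) / k) := by
  have hk0 : (0:ℝ) < k := by exact_mod_cast hk
  unfold negLogK
  split_ifs with h
  · subst h
    symm
    rw [eq_top_iff, ← ENNReal.iSup_natCast]
    refine iSup_le fun n => ?_
    obtain ⟨N, hN⟩ := exists_nat_ge (k * (n - C))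
    refine le_trans ?_ (le_iSup _ N)
    rw [← ENNReal.ofReal_natCast]
    apply ENNReal.ofReal_le_ofReal
    rw [norm_zero, max_eq_right (Real.exp_pos _).le, Real.log_exp]
    have : n - C ≤ N / k := by rw [le_div_iff₀ hk0]; linarith
    rw [neg_div]; linarith
  · have hz : 0 < ‖z‖ := norm_pos_iff.2 h
    apply le_antisymm
    · obtain ⟨N, hN⟩ := exists_nat_ge (- Real.log ‖z‖)
      refine le_trans ?_ (le_iSup _ N)
      rw [max_eq_left]
      rw [← Real.le_log_iff_exp_le hz]; linarith
    · refine iSup_le fun N => ENNReal.ofReal_le_ofReal ?_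
      have : Real.log ‖z‖ ≤ Real.log (max ‖z‖ (Real.exp (-(N:ℝ)))) :=
        Real.log_le_log hz (le_max_left _ _)
      gcongr

theorem negLogK_lsc {X : Type*} [TopologicalSpace X] (k : ℕ) (hk : 1 ≤ k) (f : X → ℂ)
    (C : X → ℝ) (hf : Continuous f) (hC : Continuous C) :
    LowerSemicontinuous (fun x => negLogK k (f x) (C x)) := by
  simp_rw [negLogK_eq_iSup k hk]
  apply lowerSemicontinuous_iSup
  intro N
  apply Continuous.lowerSemicontinuous
  apply ENNReal.continuous_ofReal.comp
  apply hC.sub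
  apply Continuous.div_const
  apply Continuous.log
  · fun_prop
  · intro x
    exact (lt_of_lt_of_le (Real.exp_pos _) (le_max_right _ _)).ne'

theorem negLogK_add (k : ℕ) (z : ℂ) (C D : ℝ) :
    negLogK k z (C + D) ≤ negLogK k z C + ENNReal.ofReal D := by
  unfold negLogK
  split_ifs with h
  · simp
  · refine le_trans (le_of_eq ?_) ENNReal.ofReal_add_le
    congr 1; ring

theorem key_circle (q : Polynomial ℂ) (i k : ℕ) (hk : 1 ≤ k) (hq : q.coeff i ≠ 0)
    (C : ℝ → ℝ) (hC : Continuous C)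
    (hb : ∀ θ : ℝ, ‖q.eval (circleMap 0 1 θ)‖ ≤ Real.exp (k * C θ)) :
    0 ≤ ((∫ θ in (0:ℝ)..(2 * Real.pi), C θ) +
        2 * Real.pi * (Real.log (q.natDegree.choose i) / k - Real.log ‖q.coeff i‖ / k)) ∧
    ∫⁻ θ in Set.Ioc (0:ℝ) (2 * Real.pi), negLogK k (q.eval (circleMap 0 1 θ)) (C θ) ≤
      ENNReal.ofReal ((∫ θ in (0:ℝ)..(2 * Real.pi), C θ) +
        2 * Real.pi * (Real.log (q.natDegree.choose i) / k - Real.log ‖q.coeff i‖ / k)) := by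
  have hk0 : (0:ℝ) < k := by exact_mod_cast hk
  have hpi := Real.pi_pos
  have hq0 : q ≠ 0 := by rintro rfl; simp at hq
  have hnull : volume {θ : ℝ | q.eval (circleMap 0 1 θ) = 0} = 0 := by
    have h1 : ({z | q.eval z = 0} : Set ℂ).Countable := by
      refine Set.Finite.countable (q.roots.toFinset.finite_toSet.subset ?_)
      intro z hz
      simpa [hq0] using hz
    exact (h1.preimage_circleMap 0 one_ne_zero).measure_zero _
  have hint := q.intervalIntegrable_mahlerMeasure
  have hae : ∀ᵐ θ ∂(volume.restrict (Set.Ioc (0:ℝ) (2 * Real.pi))),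
      negLogK k (q.eval (circleMap 0 1 θ)) (C θ) =
        ENNReal.ofReal (C θ - Real.log ‖q.eval (circleMap 0 1 θ)‖ / k) := by
    apply ae_restrict_of_ae
    filter_upwards [measure_eq_zero_iff_ae_notMem.1 hnull] with θ hθ
    replace hθ : q.eval (circleMap 0 1 θ) ≠ 0 := hθ
    simp [negLogK, hθ]
  have hI : IntervalIntegrable (fun θ => C θ - Real.log ‖q.eval (circleMap 0 1 θ)‖ / k)
      volume 0 (2 * Real.pi) := (hC.intervalIntegrable _ _).sub (hint.div_const _)
  have hnn : ∀ᵐ θ ∂(volume.restrict (Set.Ioc (0:ℝ) (2 * Real.pi))),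
      0 ≤ C θ - Real.log ‖q.eval (circleMap 0 1 θ)‖ / k := by
    apply ae_restrict_of_ae
    filter_upwards [measure_eq_zero_iff_ae_notMem.1 hnull] with θ hθ
    replace hθ : q.eval (circleMap 0 1 θ) ≠ 0 := hθ
    have := Real.log_le_log (norm_pos_iff.2 hθ) (hb θ)
    rw [Real.log_exp] at this
    rw [sub_nonneg, div_le_iff₀ hk0]; linarith
  rw [lintegral_congr_ae hae, ← ofReal_integral_eq_lintegral_ofReal _ hnn,
    ← intervalIntegral.integral_of_le (by positivity)]
  · suffices h : (∫ θ in (0:ℝ)..(2 * Real.pi),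
        (C θ - Real.log ‖q.eval (circleMap 0 1 θ)‖ / k)) ≤ ((∫ θ in (0:ℝ)..(2 * Real.pi), C θ) +
        2 * Real.pi * (Real.log (q.natDegree.choose i) / k - Real.log ‖q.coeff i‖ / k)) by
      refine ⟨le_trans ?_ h, ENNReal.ofReal_le_ofReal h⟩
      rw [intervalIntegral.integral_of_le (by positivity)]
      exact integral_nonneg_of_ae hnn
    rw [intervalIntegral.integral_sub (hC.intervalIntegrable _ _) (hint.div_const _),
      intervalIntegral.integral_div]
    have hm := q.norm_coeff_le_choose_mul_mahlerMeasure i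
    have hch : (0:ℝ) < q.natDegree.choose i := by
      exact_mod_cast Nat.choose_pos (Polynomial.le_natDegree_of_ne_zero hq)
    have h2 := Real.log_le_log (norm_pos_iff.2 hq) hm
    rw [Real.log_mul hch.ne' (Polynomial.mahlerMeasure_pos_of_ne_zero hq0).ne',
      ← Polynomial.logMahlerMeasure_eq_log_MahlerMeasure, Polynomial.logMahlerMeasure_def,
      Real.circleAverage_def, smul_eq_mul] at h2
    set J := ∫ θ in (0:ℝ)..(2 * Real.pi), Real.log ‖q.eval (circleMap 0 1 θ)‖
    have h3 : 2 * Real.pi * (Real.log ‖q.coeff i‖ - Real.log (q.natDegree.choose i)) ≤ J := by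
      have : J = 2 * Real.pi * ((2 * Real.pi)⁻¹ * J) := by field_simp
      rw [this]
      gcongr
      linarith
    have h4 := div_le_div_of_nonneg_right h3 hk0.le
    have h5 : 2 * Real.pi * (Real.log ‖q.coeff i‖ - Real.log (q.natDegree.choose i)) / k =
      2 * Real.pi * (Real.log ‖q.coeff i‖ / k - Real.log (q.natDegree.choose i) / k) := by ring
    linarith
  · exact (intervalIntegrable_iff_integrableOn_Ioc_of_le (by positivity)).1 hI

/-- Coefficients bounded by one, all exponents at most `k`. -/
def GoodPoly {n : ℕ} (k : ℕ) (f : MvPolynomial (Fin n) ℂ) : Prop :=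
  (∀ I, ‖MvPolynomial.coeff I f‖ ≤ 1) ∧ ∀ I, MvPolynomial.coeff I f ≠ 0 → ∀ i, I i ≤ k

theorem GoodPoly.eval_le {n k : ℕ} {f : MvPolynomial (Fin n) ℂ} (hf : GoodPoly k f)
    (z : Fin n → ℂ) (R : ℝ) (hR : 1 ≤ R) (hz : ∀ i, ‖z i‖ ≤ R) :
    ‖MvPolynomial.eval z f‖ ≤ Real.exp (k * (n * Real.log (2 * R))) := by
  have h1 : Real.exp (k * (n * Real.log (2 * R))) = (2 ^ k) ^ n * (R ^ k) ^ n := by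
    rw [← mul_assoc, ← Nat.cast_mul, Real.exp_nat_mul, Real.exp_log (by positivity)]
    rw [mul_pow, pow_mul, pow_mul]
  have hcard : f.support.card ≤ (2 ^ k) ^ n := by
    calc f.support.card ≤ (Fintype.piFinset (fun _ : Fin n => Finset.range (k+1))).card := by
          refine Finset.card_le_card_of_injOn (fun d => (d : Fin n → ℕ)) ?_ ?_
          · intro d hd
            have hd' : MvPolynomial.coeff d f ≠ 0 := by simpa using hd
            simp only [Finset.mem_coe, Fintype.mem_piFinset, Finset.mem_range]
            intro i
            have := hf.2 d hd' i
            omega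
          · intro a _ b _ h
            exact DFunLike.coe_injective h
      _ = (k+1)^n := by simp
      _ ≤ (2 ^ k) ^ n := Nat.pow_le_pow_left (Nat.lt_two_pow_self) n
  rw [MvPolynomial.eval_eq', h1]
  calc ‖∑ d ∈ f.support, MvPolynomial.coeff d f * ∏ i, z i ^ d i‖
      ≤ ∑ d ∈ f.support, (R ^ k) ^ n := by
        refine norm_sum_le_of_le _ fun d hd => ?_
        have hd' : MvPolynomial.coeff d f ≠ 0 := by simpa using hd
        rw [norm_mul, norm_prod]
        calc _ ≤ 1 * ∏ i : Fin n, R ^ k := by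
              refine mul_le_mul (hf.1 d) ?_ (by positivity) zero_le_one
              refine Finset.prod_le_prod (fun i _ => norm_nonneg _) fun i _ => ?_
              rw [norm_pow]
              calc _ ≤ R ^ d i := by gcongr; exact hz i
                _ ≤ R ^ k := pow_le_pow_right₀ hR (hf.2 d hd' i)
          _ = _ := by simp
    _ = f.support.card * (R ^ k) ^ n := by simp
    _ ≤ _ := by
      gcongr
      exact_mod_cast hcard

theorem exists_good_point {ι : Type} [Countable ι] (k : ι → ℕ) (hk : ∀ j, 1 ≤ k j)
    (ε : ι → ℝ≥0∞) (hε : ∑' j, ε j ≠ ⊤) (n : ℕ) :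
    ∀ f : ι → MvPolynomial (Fin n) ℂ, (∀ j, GoodPoly (k j) (f j)) →
      (∀ j, ∃ I, ‖MvPolynomial.coeff I (f j)‖ = 1) →
      ∃ z : Fin n → ℂ, (∀ i, ‖z i‖ ≤ 1) ∧
        ∑' j, ε j * negLogK (k j) (MvPolynomial.eval z (f j)) (n * Real.log 2) ≠ ⊤ := by
  induction n with
  | zero =>
    intro f hf h1
    refine ⟨0, fun i => i.elim0, ?_⟩
    have : ∀ j, negLogK (k j) (MvPolynomial.eval 0 (f j)) ((0:ℕ) * Real.log 2) = 0 := by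
      intro j
      obtain ⟨I, hI⟩ := h1 j
      have : ‖MvPolynomial.eval 0 (f j)‖ = 1 := by
        rw [MvPolynomial.eval_zero, MvPolynomial.constantCoeff_eq, ← hI, Subsingleton.elim I 0]
      have h0 : MvPolynomial.eval 0 (f j) ≠ 0 := by
        intro h; rw [h] at this; simp at this
      rw [negLogK, if_neg h0, this]; simp
    simp_rw [this]; simp
  | succ n ih =>
    intro f hf h1
    choose I hI using h1
    set g : ι → MvPolynomial (Fin n) ℂ :=
      fun j => Polynomial.coeff (MvPolynomial.finSuccEquiv ℂ n (f j)) (I j 0) with hg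
    have hg1 : ∀ j, GoodPoly (k j) (g j) := by
      intro j
      constructor
      · intro J; rw [hg]; simp only; rw [MvPolynomial.finSuccEquiv_coeff_coeff]; exact (hf j).1 _
      · intro J hJ i
        rw [hg] at hJ; simp only at hJ; rw [MvPolynomial.finSuccEquiv_coeff_coeff] at hJ
        simpa using (hf j).2 _ hJ i.succ
    have hg2 : ∀ j, ∃ J, ‖MvPolynomial.coeff J (g j)‖ = 1 := by
      intro j
      refine ⟨(I j).tail, ?_⟩
      rw [hg]; simp only; rw [MvPolynomial.finSuccEquiv_coeff_coeff, Finsupp.cons_tail]; exact hI j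
    obtain ⟨z, hz1, hz⟩ := ih g hg1 hg2
    set Q : ι → Polynomial ℂ :=
      fun j => Polynomial.map (MvPolynomial.eval z) (MvPolynomial.finSuccEquiv ℂ n (f j)) with hQ
    have hQe : ∀ j t, MvPolynomial.eval (Fin.cons t z : Fin (n+1) → ℂ) (f j) = (Q j).eval t :=
      fun j t => MvPolynomial.eval_eq_eval_mv_eval' z t (f j)
    have hl2 : 0 < Real.log 2 := Real.log_pos (by norm_num)
    have hpi := Real.pi_pos
    have hcirc : ∀ θ : ℝ, ∀ i, ‖(Fin.cons (circleMap 0 1 θ) z : Fin (n+1) → ℂ) i‖ ≤ 1 := by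
      intro θ i
      refine Fin.cases ?_ ?_ i
      · simp
      · intro i; simpa using hz1 i
    have hmain : ∀ j, ∫⁻ θ in Set.Ioc (0:ℝ) (2 * Real.pi),
        negLogK (k j) ((Q j).eval (circleMap 0 1 θ)) ((n+1:ℕ) * Real.log 2) ≤
        ENNReal.ofReal (2 * Real.pi) * (negLogK (k j) (MvPolynomial.eval z (g j)) (n * Real.log 2)
          + ENNReal.ofReal (2 * Real.log 2)) := by
      intro j
      have hk0 : (0:ℝ) < k j := by exact_mod_cast hk j
      have hco : (Q j).coeff (I j 0) = MvPolynomial.eval z (g j) := by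
        rw [hQ, hg]; simp only [Polynomial.coeff_map]
      by_cases h0 : MvPolynomial.eval z (g j) = 0
      · rw [negLogK.eq_1 _ (MvPolynomial.eval z (g j)), if_pos h0, top_add, ENNReal.mul_top]
        · exact le_top
        · simpa using hpi
      refine (key_circle (Q j) (I j 0) (k j) (hk j) (by rwa [hco]) (fun _ => (n+1:ℕ) * Real.log 2)
        continuous_const ?_).2.trans ?_
      · intro θ
        rw [← hQe]
        simpa using (hf j).eval_le _ 1 le_rfl (hcirc θ)
      · rw [negLogK, if_neg h0, hco]
        refine le_trans ?_ (mul_le_mul_right ENNReal.ofReal_add_le _)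
        rw [← ENNReal.ofReal_mul (by positivity)]
        apply ENNReal.ofReal_le_ofReal
        have hdeg : (Q j).natDegree ≤ k j := by
          refine (Polynomial.natDegree_map_le).trans ?_
          rw [MvPolynomial.natDegree_finSuccEquiv, MvPolynomial.degreeOf_le_iff]
          intro m hm
          exact (hf j).2 m (by simpa using hm) 0
        have hle : I j 0 ≤ (Q j).natDegree :=
          Polynomial.le_natDegree_of_ne_zero (by rwa [hco])
        have hch : Real.log ((Q j).natDegree.choose (I j 0)) / k j ≤ Real.log 2 := by
          rw [div_le_iff₀ hk0, mul_comm, ← Real.log_pow]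
          apply Real.log_le_log
          · exact_mod_cast Nat.choose_pos hle
          · have h1 := (Nat.choose_le_two_pow (Q j).natDegree (I j 0))
            have h2 : 2 ^ (Q j).natDegree ≤ 2 ^ (k j) := Nat.pow_le_pow_right (by norm_num) hdeg
            exact_mod_cast h1.trans h2
        rw [intervalIntegral.integral_const, smul_eq_mul, sub_zero, ← mul_add]
        apply mul_le_mul_of_nonneg_left _ (by positivity)
        push_cast
        linarith
    have hmeas : ∀ j, Measurable fun θ : ℝ =>
        negLogK (k j) ((Q j).eval (circleMap 0 1 θ)) ((n+1:ℕ) * Real.log 2) := by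
      intro j
      refine (negLogK_lsc (k j) (hk j) _ (fun _ => (n+1:ℕ) * Real.log 2) ?_ continuous_const).measurable
      exact (Q j).continuous.comp (continuous_circleMap 0 1)
    have hfin : ∫⁻ θ in Set.Ioc (0:ℝ) (2 * Real.pi), ∑' j, ε j *
        negLogK (k j) ((Q j).eval (circleMap 0 1 θ)) ((n+1:ℕ) * Real.log 2) ≠ ⊤ := by
      rw [lintegral_tsum fun j => ((hmeas j).const_mul _).aemeasurable]
      refine ne_top_of_le_ne_top ?_ (ENNReal.tsum_le_tsum fun j =>
        (lintegral_const_mul (ε j) (hmeas j)).le.trans (mul_le_mul_right (hmain j) (ε j)))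
      have hr : ∀ a b c d : ℝ≥0∞, a * (b * (c + d)) = b * (a * c) + b * d * a := by
        intros; ring
      simp_rw [hr, ENNReal.tsum_add, ENNReal.tsum_mul_left]
      finiteness
    have hae := ae_lt_top (Measurable.tsum fun j => (hmeas j).const_mul (ε j)) hfin
    have hne : (volume.restrict (Set.Ioc (0:ℝ) (2 * Real.pi))) ≠ 0 := by
      rw [Ne, Measure.restrict_eq_zero, Real.volume_Ioc]
      simpa using hpi
    have : NeZero (volume.restrict (Set.Ioc (0:ℝ) (2 * Real.pi))) := ⟨hne⟩
    obtain ⟨θ, hθ⟩ := hae.exists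
    refine ⟨Fin.cons (circleMap 0 1 θ) z, hcirc θ, ?_⟩
    simp_rw [hQe]
    exact hθ.ne

theorem submean_negLogK {m : ℕ} (k : ℕ) (hk : 1 ≤ k) (f : MvPolynomial (Fin m) ℂ)
    (L : EuclideanSpace ℂ (Fin m) → ℝ) (hL : Continuous L) (hL0 : ∀ z, 0 ≤ L z)
    (hb : ∀ z : EuclideanSpace ℂ (Fin m),
      ‖MvPolynomial.eval (fun i => z i) f‖ ≤ Real.exp (k * L z))
    (a b : EuclideanSpace ℂ (Fin m)) (r : ℝ) :
    (∫⁻ θ in Set.Ioc (0:ℝ) (2 * Real.pi),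
      negLogK k (MvPolynomial.eval (fun i => (a + ((r:ℂ) * Complex.exp (θ * Complex.I)) • b) i) f)
        (L (a + ((r:ℂ) * Complex.exp (θ * Complex.I)) • b)))
      + ENNReal.ofReal (2 * Real.pi) * ENNReal.ofReal (L a) ≤
    (∫⁻ θ in Set.Ioc (0:ℝ) (2 * Real.pi),
      ENNReal.ofReal (L (a + ((r:ℂ) * Complex.exp (θ * Complex.I)) • b)))
      + ENNReal.ofReal (2 * Real.pi) * negLogK k (MvPolynomial.eval (fun i => a i) f) (L a) := by
  have hk0 : (0:ℝ) < k := by exact_mod_cast hk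
  have hpi := Real.pi_pos
  by_cases h0 : MvPolynomial.eval (fun i => a i) f = 0
  · rw [negLogK.eq_1 _ (MvPolynomial.eval (fun i => a i) f), if_pos h0, ENNReal.mul_top]
    · simp
    · simpa using hpi
  set q : Polynomial ℂ := MvPolynomial.aeval
    (fun i => Polynomial.C (a i) + Polynomial.C (r * b i) * Polynomial.X) f with hq
  have hqe : ∀ t : ℂ, q.eval t = MvPolynomial.eval (fun i => a i + r * b i * t) f := by
    intro t
    have := MvPolynomial.comp_aeval_apply
      (f := fun i => Polynomial.C (a i) + Polynomial.C (r * b i) * Polynomial.X)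
      (Polynomial.aeval t : Polynomial ℂ →ₐ[ℂ] ℂ) f
    rw [← hq] at this
    simpa [MvPolynomial.coe_aeval_eq_eval] using this
  have hqc : ∀ θ : ℝ, q.eval (circleMap 0 1 θ) = MvPolynomial.eval
      (fun i => (a + ((r:ℂ) * Complex.exp (θ * Complex.I)) • b) i) f := by
    intro θ
    rw [hqe]
    congr 2
    ext i
    simp [circleMap]
    ring
  have hq0 : q.coeff 0 = MvPolynomial.eval (fun i => a i) f := by
    rw [Polynomial.coeff_zero_eq_eval_zero, hqe]; simp
  have hc : Continuous fun θ : ℝ => L (a + ((r:ℂ) * Complex.exp (θ * Complex.I)) • b) := by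
    fun_prop
  have key := key_circle q 0 k hk (by rwa [hq0]) _ hc (by intro θ; rw [hqc]; exact hb _)
  simp_rw [hqc] at key
  rw [negLogK.eq_1 _ (MvPolynomial.eval (fun i => a i) f), if_neg h0]
  obtain ⟨k1, k2⟩ := key
  refine (add_le_add_left k2 _).trans ?_
  have hnn : 0 ≤ L a - Real.log ‖MvPolynomial.eval (fun i => a i) f‖ / k := by
    have := Real.log_le_log (norm_pos_iff.2 h0) (hb a)
    rw [Real.log_exp] at this
    rw [sub_nonneg, div_le_iff₀ hk0]; linarith
  rw [← ofReal_integral_eq_lintegral_ofReal, ← intervalIntegral.integral_of_le (by positivity),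
    ← ENNReal.ofReal_mul (by positivity), ← ENNReal.ofReal_mul (by positivity),
    ← ENNReal.ofReal_add k1, ← ENNReal.ofReal_add]
  · apply ENNReal.ofReal_le_ofReal
    rw [hq0]
    simp
    linarith
  · exact intervalIntegral.integral_nonneg (by positivity) fun _ _ => hL0 _
  · positivity
  · have := hL0 a
    positivity
  · exact (hc.integrableOn_Icc).mono_set Set.Ioc_subset_Icc_self
  · exact Filter.Eventually.of_forall fun _ => hL0 _

theorem pos_neg_part (l : ℝ) (hl : 0 ≤ l) (G : ℝ≥0∞) :
    erealToENNReal ((l : EReal) - (G : EReal)) + G =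
      erealToENNReal (-((l : EReal) - (G : EReal))) + ENNReal.ofReal l ∧
    erealToENNReal ((l : EReal) - (G : EReal)) ≤ ENNReal.ofReal l ∧
    erealToENNReal (-((l : EReal) - (G : EReal))) ≤ G := by
  induction G using ENNReal.recTopCoe with
  | top => simp [erealToENNReal]
  | coe g =>
    have e : ((l : EReal) - (((g : ℝ≥0∞)) : EReal)) = ((l - g : ℝ) : EReal) := by
      rw [EReal.coe_sub]; rfl
    rw [e, ← EReal.coe_neg, erealToENNReal, erealToENNReal, if_neg (EReal.coe_ne_top _),
      if_neg (EReal.coe_ne_top _), EReal.toReal_coe, EReal.toReal_coe,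
      ← ENNReal.ofReal_coe_nnreal]
    have hg : (0:ℝ) ≤ g := g.2
    refine ⟨?_, ENNReal.ofReal_le_ofReal (by linarith), ENNReal.ofReal_le_ofReal (by linarith)⟩
    rcases le_total l g with h | h
    · rw [ENNReal.ofReal_of_nonpos (p := l - g) (by linarith), ← ENNReal.ofReal_add (by linarith) hl]
      simp
    · rw [ENNReal.ofReal_of_nonpos (p := -(l - g)) (by linarith),
        ← ENNReal.ofReal_add (by linarith) hg]
      simp

theorem psh_of_submean {m : ℕ} (l : EuclideanSpace ℂ (Fin m) → ℝ) (hl : Continuous l)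
    (hl0 : ∀ z, 0 ≤ l z) (G : EuclideanSpace ℂ (Fin m) → ℝ≥0∞) (hG : LowerSemicontinuous G)
    (hfin : ∃ z, G z ≠ ⊤)
    (hsub : ∀ (a b : EuclideanSpace ℂ (Fin m)) (r : ℝ),
      (∫⁻ θ in Set.Ioc (0:ℝ) (2 * Real.pi),
        G (a + ((r:ℂ) * Complex.exp (θ * Complex.I)) • b))
        + ENNReal.ofReal (2 * Real.pi) * ENNReal.ofReal (l a) ≤
      (∫⁻ θ in Set.Ioc (0:ℝ) (2 * Real.pi),
        ENNReal.ofReal (l (a + ((r:ℂ) * Complex.exp (θ * Complex.I)) • b)))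
        + ENNReal.ofReal (2 * Real.pi) * G a) :
    IsPSH (fun z => ((l z : ℝ) : EReal) - ((G z : ℝ≥0∞) : EReal)) := by
  have hpi := Real.pi_pos
  refine ⟨?_, ?_, ?_, ?_⟩
  · simp_rw [sub_eq_add_neg]
    refine UpperSemicontinuous.add' ?_ ?_ ?_
    · exact (continuous_coe_real_ereal.comp hl).upperSemicontinuous
    · refine Continuous.comp_lowerSemicontinuous_antitone
        (g := fun x : ℝ≥0∞ => -(x : EReal)) (continuous_neg.comp continuous_coe_ennreal_ereal) hG ?_
      intro x y hxy
      exact EReal.neg_le_neg_iff.2 (by exact_mod_cast hxy)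
    · intro z
      exact EReal.continuousAt_add (by simp) (by simp)
  · obtain ⟨z, hz⟩ := hfin
    refine ⟨z, ?_⟩
    lift G z to NNReal using hz with g
    exact EReal.coe_ne_bot (l z - g)
  · intro z
    have h2 : ((l z : ℝ) : EReal) - ((G z : ℝ≥0∞) : EReal) ≤ (l z : EReal) := by
      rw [sub_eq_add_neg]
      calc _ ≤ (l z : EReal) + 0 := by gcongr; simpa using EReal.coe_ennreal_nonneg (G z)
        _ = _ := add_zero _
    exact ne_top_of_le_ne_top (EReal.coe_ne_top _) h2
  · intro a b r hr
    by_cases hGa : G a = ⊤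
    · simp [hGa]
    have hs := hsub a b r
    unfold circleLineMean erealIntegral
    set c : ℝ → EuclideanSpace ℂ (Fin m) :=
      fun θ => a + ((r:ℂ) * Complex.exp (θ * Complex.I)) • b with hc
    have hcc : Continuous c := by fun_prop
    change (∫⁻ θ in Set.Ioc (0:ℝ) (2 * Real.pi), G (c θ)) + _ ≤
      (∫⁻ θ in Set.Ioc (0:ℝ) (2 * Real.pi), ENNReal.ofReal (l (c θ))) + _ at hs
    change _ ≤ (((2 * Real.pi)⁻¹ : ℝ) : EReal) *
      (((∫⁻ θ in Set.Ioc (0:ℝ) (2 * Real.pi),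
        erealToENNReal (((l (c θ) : ℝ) : EReal) - ((G (c θ) : ℝ≥0∞) : EReal)) : ℝ≥0∞) : EReal) -
      ((∫⁻ θ in Set.Ioc (0:ℝ) (2 * Real.pi),
        erealToENNReal (-(((l (c θ) : ℝ) : EReal) - ((G (c θ) : ℝ≥0∞) : EReal))) : ℝ≥0∞) : EReal))
    have hGm : Measurable fun θ => G (c θ) := hG.measurable.comp hcc.measurable
    have hlm : Measurable fun θ => ENNReal.ofReal (l (c θ)) :=
      (ENNReal.continuous_ofReal.comp (hl.comp hcc)).measurable
    have e1 : (∫⁻ θ in Set.Ioc (0:ℝ) (2 * Real.pi),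
        erealToENNReal (((l (c θ) : ℝ) : EReal) - ((G (c θ) : ℝ≥0∞) : EReal))) +
        (∫⁻ θ in Set.Ioc (0:ℝ) (2 * Real.pi), G (c θ)) =
      (∫⁻ θ in Set.Ioc (0:ℝ) (2 * Real.pi),
        erealToENNReal (-(((l (c θ) : ℝ) : EReal) - ((G (c θ) : ℝ≥0∞) : EReal)))) +
        (∫⁻ θ in Set.Ioc (0:ℝ) (2 * Real.pi), ENNReal.ofReal (l (c θ))) := by
      rw [← lintegral_add_right _ hGm, ← lintegral_add_right _ hlm]
      exact lintegral_congr fun θ => (pos_neg_part _ (hl0 _) _).1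
    have e2 : (∫⁻ θ in Set.Ioc (0:ℝ) (2 * Real.pi),
        erealToENNReal (((l (c θ) : ℝ) : EReal) - ((G (c θ) : ℝ≥0∞) : EReal))) ≤
        ∫⁻ θ in Set.Ioc (0:ℝ) (2 * Real.pi), ENNReal.ofReal (l (c θ)) :=
      lintegral_mono fun θ => (pos_neg_part _ (hl0 _) _).2.1
    have e3 : (∫⁻ θ in Set.Ioc (0:ℝ) (2 * Real.pi),
        erealToENNReal (-(((l (c θ) : ℝ) : EReal) - ((G (c θ) : ℝ≥0∞) : EReal)))) ≤
        ∫⁻ θ in Set.Ioc (0:ℝ) (2 * Real.pi), G (c θ) :=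
      lintegral_mono fun θ => (pos_neg_part _ (hl0 _) _).2.2
    have e4 : ∫⁻ θ in Set.Ioc (0:ℝ) (2 * Real.pi), ENNReal.ofReal (l (c θ)) ≠ ⊤ := by
      have : IntegrableOn (fun θ => l (c θ)) (Set.Ioc (0:ℝ) (2 * Real.pi)) :=
        ((hl.comp hcc).integrableOn_Icc).mono_set Set.Ioc_subset_Icc_self
      exact this.lintegral_lt_top.ne
    generalize (∫⁻ θ in Set.Ioc (0:ℝ) (2 * Real.pi),
        erealToENNReal (((l (c θ) : ℝ) : EReal) - ((G (c θ) : ℝ≥0∞) : EReal))) = P at *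
    generalize (∫⁻ θ in Set.Ioc (0:ℝ) (2 * Real.pi),
        erealToENNReal (-(((l (c θ) : ℝ) : EReal) - ((G (c θ) : ℝ≥0∞) : EReal)))) = N at *
    generalize (∫⁻ θ in Set.Ioc (0:ℝ) (2 * Real.pi), G (c θ)) = IG at *
    generalize (∫⁻ θ in Set.Ioc (0:ℝ) (2 * Real.pi), ENNReal.ofReal (l (c θ))) = Il at *
    have e5 : IG ≠ ⊤ := by
      refine ne_top_of_le_ne_top ?_ (le_self_add.trans hs)
      finiteness
    have e6 := ne_top_of_le_ne_top e5 e3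
    have e7 := ne_top_of_le_ne_top e4 e2
    have hla := hl0 a
    beta_reduce
    generalize l a = la at *
    generalize G a = Ga at *
    lift P to NNReal using e7
    lift N to NNReal using e6
    lift IG to NNReal using e5
    lift Il to NNReal using e4
    lift Ga to NNReal using hGa
    have f1 : (P:ℝ) + IG = N + Il := by exact_mod_cast e1
    have f2 : (IG:ℝ) + 2 * Real.pi * la ≤ Il + 2 * Real.pi * Ga := by
      have := ENNReal.toReal_mono (by finiteness) hs
      rw [ENNReal.toReal_add (by finiteness) (by finiteness),
        ENNReal.toReal_add (by finiteness) (by finiteness)] at this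
      simpa [hla, hpi.le] using this
    change ((la - Ga : ℝ) : EReal) ≤ (((2 * Real.pi)⁻¹ : ℝ) : EReal) * ((P - N : ℝ) : EReal)
    rw [← EReal.coe_mul, EReal.coe_le_coe_iff, inv_mul_eq_div, le_div_iff₀ (by positivity)]
    linarith

theorem pluripolar_of_family {m : ℕ} {ι : Type} [Countable ι] (k : ι → ℕ) (hk : ∀ j, 1 ≤ k j)
    (ε : ι → ℝ≥0∞) (hε : ∑' j, ε j ≠ ⊤) (f : ι → MvPolynomial (Fin m) ℂ)
    (hf : ∀ j, GoodPoly (k j) (f j)) (h1 : ∀ j, ∃ I, ‖MvPolynomial.coeff I (f j)‖ = 1)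
    (E : Set (EuclideanSpace ℂ (Fin m)))
    (hE : ∀ z ∈ E, ∑' j, ε j * negLogK (k j) (MvPolynomial.eval (fun i => z i) (f j))
      (m * Real.log (2 * (1 + ‖z‖))) = ⊤) : Pluripolar E := by
  set L : EuclideanSpace ℂ (Fin m) → ℝ := fun z => m * Real.log (2 * (1 + ‖z‖)) with hLdef
  have hL : Continuous L := by
    refine continuous_const.mul (Continuous.log (by fun_prop) fun z => ?_)
    positivity
  have hL0 : ∀ z, 0 ≤ L z := fun z => by
    have : 0 ≤ Real.log (2 * (1 + ‖z‖)) := Real.log_nonneg (by nlinarith [norm_nonneg z])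
    simp only [hLdef]; positivity
  have hb : ∀ j, ∀ z : EuclideanSpace ℂ (Fin m),
      ‖MvPolynomial.eval (fun i => z i) (f j)‖ ≤ Real.exp (k j * L z) := fun j z => by
    refine (hf j).eval_le _ (1 + ‖z‖) (by linarith [norm_nonneg z]) fun i => ?_
    have := PiLp.norm_apply_le z i
    linarith
  have hfc : ∀ j, Continuous fun z : EuclideanSpace ℂ (Fin m) =>
      MvPolynomial.eval (fun i => z i) (f j) := fun j =>
    (MvPolynomial.continuous_eval (f j)).comp (by fun_prop)
  set W := ∑' j, ε j with hW
  set G : EuclideanSpace ℂ (Fin m) → ℝ≥0∞ := fun z =>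
    ∑' j, ε j * negLogK (k j) (MvPolynomial.eval (fun i => z i) (f j)) (L z) with hG
  have hlsc0 : ∀ j, LowerSemicontinuous fun z : EuclideanSpace ℂ (Fin m) =>
      negLogK (k j) (MvPolynomial.eval (fun i => z i) (f j)) (L z) := fun j =>
    negLogK_lsc (k j) (hk j) _ _ (hfc j) hL
  have hεj : ∀ j, ε j ≠ ⊤ := fun j => ne_top_of_le_ne_top hε (ENNReal.le_tsum j)
  have hlsc : LowerSemicontinuous G := by
    refine lowerSemicontinuous_tsum fun j => ?_
    refine Continuous.comp_lowerSemicontinuous (g := fun x => ε j * x)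
      (ENNReal.continuous_const_mul (hεj j)) (hlsc0 j) ?_
    intro x y hxy
    exact mul_le_mul_right hxy _
  have hWL : ∀ z, ENNReal.ofReal (W.toReal * L z) = W * ENNReal.ofReal (L z) := fun z => by
    rw [ENNReal.ofReal_mul ENNReal.toReal_nonneg, ENNReal.ofReal_toReal hε]
  refine ⟨fun z => ((W.toReal * L z : ℝ) : EReal) - ((G z : ℝ≥0∞) : EReal),
    psh_of_submean (fun z => W.toReal * L z) (continuous_const.mul hL)
      (fun z => mul_nonneg ENNReal.toReal_nonneg (hL0 z)) G hlsc ?_ ?_, ?_⟩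
  · obtain ⟨z, -, hz⟩ := exists_good_point k hk ε hε m f hf h1
    refine ⟨WithLp.toLp 2 z, ?_⟩
    set z' : EuclideanSpace ℂ (Fin m) := WithLp.toLp 2 z with hz'
    have hle : ∀ j, ε j * negLogK (k j) (MvPolynomial.eval (fun i => z' i) (f j)) (L z') ≤
        ε j * negLogK (k j) (MvPolynomial.eval z (f j)) (m * Real.log 2) +
          ENNReal.ofReal (L z' - m * Real.log 2) * ε j := by
      intro j
      rw [mul_comm (ENNReal.ofReal _), ← mul_add]
      refine mul_le_mul_right ?_ _
      have := negLogK_add (k j) (MvPolynomial.eval z (f j)) (m * Real.log 2)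
        (L z' - m * Real.log 2)
      rw [add_sub_cancel] at this
      exact this
    refine ne_top_of_le_ne_top ?_ (ENNReal.tsum_le_tsum hle)
    rw [ENNReal.tsum_add, ENNReal.tsum_mul_left]
    finiteness
  · intro a b r
    have hcc : Continuous fun θ : ℝ => a + ((r:ℂ) * Complex.exp (θ * Complex.I)) • b := by
      fun_prop
    have hm : ∀ j, Measurable fun θ : ℝ => negLogK (k j) (MvPolynomial.eval
        (fun i => (a + ((r:ℂ) * Complex.exp (θ * Complex.I)) • b) i) (f j))
        (L (a + ((r:ℂ) * Complex.exp (θ * Complex.I)) • b)) := fun j =>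
      (hlsc0 j).measurable.comp hcc.measurable
    simp_rw [hWL, hG]
    rw [lintegral_tsum fun j => ((hm j).const_mul _).aemeasurable,
      lintegral_const_mul' _ _ hε]
    rw [tsum_congr fun j => lintegral_const_mul (ε j) (hm j)]
    rw [hW, mul_left_comm, ← ENNReal.tsum_mul_right, ← ENNReal.tsum_mul_right,
      ← ENNReal.tsum_mul_left, ← ENNReal.tsum_add, ← ENNReal.tsum_add]
    refine ENNReal.tsum_le_tsum fun j => ?_
    rw [mul_left_comm _ (ε j), ← mul_add, ← mul_add]
    exact mul_le_mul_right (submean_negLogK (k j) (hk j) (f j) L hL hL0 (hb j) a b r) _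
  · intro z hz
    have : G z = ⊤ := hE z hz
    simp [this]

theorem card_antidiagonalTuple_le (n k : ℕ) :
    (Finset.Nat.antidiagonalTuple n k).card ≤ (2 ^ n) ^ k := by
  calc (Finset.Nat.antidiagonalTuple n k).card
      ≤ (Fintype.piFinset (fun _ : Fin n => Finset.range (k+1))).card := by
        refine Finset.card_le_card ?_
        intro I hI
        rw [Finset.Nat.mem_antidiagonalTuple] at hI
        simp only [Fintype.mem_piFinset, Finset.mem_range]
        intro i
        have := Finset.single_le_sum (f := I) (fun _ _ => Nat.zero_le _) (Finset.mem_univ i)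
        omega
    _ = (k+1)^n := by simp
    _ ≤ (2 ^ k) ^ n := Nat.pow_le_pow_left (Nat.lt_two_pow_self) n
    _ = _ := by rw [← pow_mul, ← pow_mul, mul_comm]

theorem conv_of_bound {n : ℕ} (S : MvPowerSeries (Fin n) ℂ) (A : ℝ) (hA : 0 < A)
    (h : ∀ k, 1 ≤ k → ∀ I ∈ Finset.Nat.antidiagonalTuple n k,
      ‖MvPowerSeries.coeff (Finsupp.equivFunOnFinite.symm I) S‖ ≤ A ^ k) :
    ConvUnifNearZero S := by
  set K : ℝ := 1 + ‖MvPowerSeries.coeff (Finsupp.equivFunOnFinite.symm (0 : Fin n → ℕ)) S‖ with hK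
  have hK1 : 1 ≤ K := by simp [hK]
  have h' : ∀ k, ∀ I ∈ Finset.Nat.antidiagonalTuple n k,
      ‖MvPowerSeries.coeff (Finsupp.equivFunOnFinite.symm I) S‖ ≤ K * A ^ k := by
    intro k I hI
    rcases Nat.eq_zero_or_pos k with rfl | hk
    · rw [Finset.Nat.antidiagonalTuple_zero_right, Finset.mem_singleton] at hI
      subst hI
      simp [hK]
    · have := h k hk I hI
      have hp : 0 ≤ A ^ k := by positivity
      nlinarith
  refine ⟨(2 * 2 ^ n * A)⁻¹, by positivity, ?_⟩
  refine ⟨_, tendstoUniformlyOn_tsum_nat (u := fun k => K * (1/2:ℝ)^k)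
    (f := fun k (z : EuclideanSpace ℂ (Fin n)) => ∑ I ∈ Finset.Nat.antidiagonalTuple n k,
    MvPowerSeries.coeff (Finsupp.equivFunOnFinite.symm I) S * ∏ i, z i ^ I i) ?_ ?_⟩
  · exact (summable_geometric_of_lt_one (by norm_num) (by norm_num)).mul_left _
  · intro k z hz
    have hz' : ‖z‖ ≤ (2 * 2 ^ n * A)⁻¹ := by
      have := mem_ball_zero_iff.1 hz
      exact this.le
    calc _ ≤ ∑ I ∈ Finset.Nat.antidiagonalTuple n k, K * A ^ k * ((2 * 2 ^ n * A)⁻¹) ^ k := by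
          refine norm_sum_le_of_le _ fun I hI => ?_
          rw [norm_mul, norm_prod]
          refine mul_le_mul (h' k I hI) ?_ (by positivity) (by positivity)
          calc ∏ i, ‖z i ^ I i‖ ≤ ∏ i, ((2 * 2 ^ n * A)⁻¹) ^ I i := by
                refine Finset.prod_le_prod (fun i _ => norm_nonneg _) fun i _ => ?_
                rw [norm_pow]
                gcongr
                exact (PiLp.norm_apply_le z i).trans hz'
            _ = _ := by
                rw [Finset.prod_pow_eq_pow_sum, Finset.Nat.mem_antidiagonalTuple.1 hI]
      _ = (Finset.Nat.antidiagonalTuple n k).card * (K * A ^ k * ((2 * 2 ^ n * A)⁻¹) ^ k) := by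
          simp
      _ ≤ (2 ^ n) ^ k * (K * A ^ k * ((2 * 2 ^ n * A)⁻¹) ^ k) := by
          gcongr
          exact_mod_cast card_antidiagonalTuple_le n k
      _ = K * (2 ^ n * A * (2 * 2 ^ n * A)⁻¹) ^ k := by
          rw [mul_pow, mul_pow]; ring
      _ = _ := by
          congr 2
          field_simp

/-- Dehomogenization of a homogeneous polynomial in the `i`-th chart. -/
noncomputable def dehom {m : ℕ} (c : (Fin (m + 1) → ℕ) → ℂ) (k : ℕ) (i : Fin (m + 1)) :
    MvPolynomial (Fin m) ℂ :=
  ∑ I ∈ Finset.Nat.antidiagonalTuple (m + 1) k,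
    MvPolynomial.monomial (Finsupp.equivFunOnFinite.symm (fun j => I (i.succAbove j))) (c I)

theorem removeNth_inj {m k : ℕ} (i : Fin (m + 1)) {I J : Fin (m + 1) → ℕ}
    (hI : I ∈ Finset.Nat.antidiagonalTuple (m + 1) k)
    (hJ : J ∈ Finset.Nat.antidiagonalTuple (m + 1) k)
    (h : ∀ j, I (i.succAbove j) = J (i.succAbove j)) : I = J := by
  rw [Finset.Nat.mem_antidiagonalTuple, Fin.sum_univ_succAbove _ i] at hI hJ
  have h2 : ∑ j, I (i.succAbove j) = ∑ j, J (i.succAbove j) := Finset.sum_congr rfl fun j _ => h j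
  ext l
  rcases Fin.eq_self_or_eq_succAbove i l with rfl | ⟨j, rfl⟩
  · omega
  · exact h j

theorem coeff_dehom {m : ℕ} (c : (Fin (m + 1) → ℕ) → ℂ) (k : ℕ) (i : Fin (m + 1))
    (I : Fin (m + 1) → ℕ) (hI : I ∈ Finset.Nat.antidiagonalTuple (m + 1) k) :
    MvPolynomial.coeff (Finsupp.equivFunOnFinite.symm (fun j => I (i.succAbove j))) (dehom c k i)
      = c I := by
  classical
  rw [dehom, MvPolynomial.coeff_sum, Finset.sum_eq_single I]
  · simp
  · intro J hJ hne
    rw [MvPolynomial.coeff_monomial, if_neg]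
    intro h
    apply hne
    refine removeNth_inj i hJ hI fun j => ?_
    exact congrFun (Finsupp.equivFunOnFinite.symm.injective h) j
  · intro h; exact absurd hI h

theorem coeff_dehom_cases {m : ℕ} (c : (Fin (m + 1) → ℕ) → ℂ) (k : ℕ) (i : Fin (m + 1))
    (J : Fin m →₀ ℕ) (hJ : MvPolynomial.coeff J (dehom c k i) ≠ 0) :
    ∃ I ∈ Finset.Nat.antidiagonalTuple (m + 1) k,
      J = Finsupp.equivFunOnFinite.symm (fun j => I (i.succAbove j)) := by
  classical
  rw [dehom, MvPolynomial.coeff_sum] at hJ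
  obtain ⟨I, hI, hne⟩ := Finset.exists_ne_zero_of_sum_ne_zero hJ
  refine ⟨I, hI, ?_⟩
  rw [MvPolynomial.coeff_monomial] at hne
  by_contra h
  exact hne (if_neg fun h' => h h'.symm)

theorem dehom_good {m : ℕ} (c : (Fin (m + 1) → ℕ) → ℂ) (k : ℕ) (i : Fin (m + 1))
    (hc : ∀ I ∈ Finset.Nat.antidiagonalTuple (m + 1) k, ‖c I‖ ≤ 1) :
    GoodPoly k (dehom c k i) := by
  constructor
  · intro J
    by_cases hJ : MvPolynomial.coeff J (dehom c k i) = 0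
    · simp [hJ]
    · obtain ⟨I, hI, rfl⟩ := coeff_dehom_cases c k i J hJ
      rw [coeff_dehom c k i I hI]; exact hc I hI
  · intro J hJ l
    obtain ⟨I, hI, rfl⟩ := coeff_dehom_cases c k i J hJ
    rw [Finset.Nat.mem_antidiagonalTuple] at hI
    have := Finset.single_le_sum (f := I) (fun _ _ => Nat.zero_le _)
      (Finset.mem_univ (i.succAbove l))
    simp
    omega

theorem eval_dehom {m : ℕ} (c : (Fin (m + 1) → ℕ) → ℂ) (k : ℕ) (i : Fin (m + 1))
    (v : Fin (m + 1) → ℂ) (hv : v i ≠ 0) (w : Fin m → ℂ)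
    (hw : ∀ j, w j = v (i.succAbove j) / v i) :
    MvPolynomial.eval w (dehom c k i) * v i ^ k =
      ∑ I ∈ Finset.Nat.antidiagonalTuple (m + 1) k, c I * ∏ l, v l ^ I l := by
  rw [dehom, map_sum, Finset.sum_mul]
  refine Finset.sum_congr rfl fun I hI => ?_
  rw [Finset.Nat.mem_antidiagonalTuple, Fin.sum_univ_succAbove _ i] at hI
  rw [MvPolynomial.eval_monomial, Fin.prod_univ_succAbove _ i, Finsupp.prod_fintype _ _ (by simp),
    mul_assoc]
  congr 1
  simp only [Finsupp.equivFunOnFinite_symm_apply_apply, hw, div_pow]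
  rw [Finset.prod_div_distrib, Finset.prod_pow_eq_pow_sum, ← hI, pow_add]
  field_simp

theorem HasPosRadius.bound {c : ℕ → ℂ} (h : HasPosRadius c) :
    ∃ B : ℝ, 0 < B ∧ ∀ k, 1 ≤ k → ‖c k‖ ≤ B ^ k := by
  obtain ⟨r, hr, hs⟩ := h
  obtain ⟨M, hM⟩ := hs.tendsto_atTop_zero.bddAbove_range
  have hM' : ∀ k, ‖c k‖ * r ^ k ≤ max M 1 := fun k =>
    (hM (Set.mem_range_self k)).trans (le_max_left _ _)
  have h1 : 1 ≤ max M 1 := le_max_right _ _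
  refine ⟨max M 1 / r, by positivity, fun k hk => ?_⟩
  rw [div_pow, le_div_iff₀ (by positivity)]
  exact (hM' k).trans (le_self_pow₀ h1 (by omega))

/-- If the direction set `F'` is not pluripolar, then the suspension `S₀(F)` is normal:
every formal power series converging along each leaf converges uniformly near `0`. -/
theorem normal_of_nonpluripolar_directions {m : ℕ} (hm : 1 ≤ m)
    (F : Set (EuclideanSpace ℂ (Fin (m + 1)))) (hFne : F.Nonempty)
    (hFsub : F ⊆ Metric.sphere (0 : EuclideanSpace ℂ (Fin (m + 1))) 1)
    (hpp : ¬ Pluripolar (dirSet F)) :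
    ∀ S : MvPowerSeries (Fin (m + 1)) ℂ,
      (∀ v ∈ F, HasPosRadius (lineCoeff S v)) → ConvUnifNearZero S := by
  intro S hS
  by_contra hconv
  apply hpp
  set c : (Fin (m + 1) → ℕ) → ℂ :=
    fun I => MvPowerSeries.coeff (Finsupp.equivFunOnFinite.symm I) S with hc
  have hex : ∀ j : ℕ, ∃ k : ℕ, 1 ≤ k ∧ ∃ I ∈ Finset.Nat.antidiagonalTuple (m + 1) k,
      Real.exp (4 ^ j) ^ k < ‖c I‖ ∧
      ∀ J ∈ Finset.Nat.antidiagonalTuple (m + 1) k, ‖c J‖ ≤ ‖c I‖ := by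
    intro j
    by_contra hno
    push Not at hno
    refine hconv (conv_of_bound S (Real.exp (4 ^ j)) (Real.exp_pos _) fun k hk I hI => ?_)
    obtain ⟨I', hI', hmax⟩ := Finset.exists_max_image
      (Finset.Nat.antidiagonalTuple (m + 1) k) (fun J => ‖c J‖) ⟨I, hI⟩
    by_contra hlt
    push Not at hlt
    obtain ⟨J, hJ, hlt'⟩ := hno k hk I' hI' (lt_of_lt_of_le hlt (hmax I hI))
    exact absurd (hmax J hJ) (not_le.2 hlt')
  choose K hK I hI hbig hmax using hex
  have hcpos : ∀ j, 0 < ‖c (I j)‖ := fun j => lt_trans (by positivity) (hbig j)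
  refine pluripolar_of_family (ι := Fin (m + 1) × ℕ) (fun p => K p.2) (fun p => hK p.2)
    (fun p => (2⁻¹ : ℝ≥0∞) ^ p.2) ?_
    (fun p => dehom (fun J => c J / c (I p.2)) (K p.2) p.1) ?_ ?_ _ ?_
  · refine ne_of_eq_of_ne (ENNReal.tsum_prod (f := fun (_ : Fin (m + 1)) (j : ℕ) => (2⁻¹ : ℝ≥0∞) ^ j)) ?_
    simp only [ENNReal.tsum_geometric, tsum_fintype, Finset.sum_const]
    simp [ENNReal.mul_eq_top]
  · intro p
    apply dehom_good
    intro J hJ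
    rw [norm_div, div_le_one (hcpos _)]
    exact hmax _ J hJ
  · intro p
    refine ⟨Finsupp.equivFunOnFinite.symm (fun l => I p.2 (p.1.succAbove l)), ?_⟩
    · rw [coeff_dehom _ _ _ _ (hI p.2), norm_div, div_self (hcpos _).ne']
  · intro w hw
    obtain ⟨i, v, hvF, hvi, hwv⟩ := Set.mem_iUnion.1 hw
    obtain ⟨B, hB, hBk⟩ := (hS v hvF).bound
    have hvn : 0 < ‖v i‖ := norm_pos_iff.2 hvi
    by_contra hne
    have ht := ENNReal.tendsto_cofinite_zero_of_tsum_ne_top hne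
    have hinj : Function.Injective (fun j : ℕ => ((i, j) : Fin (m + 1) × ℕ)) :=
      fun a b h => (Prod.mk.inj h).2
    have ht2 := ht.comp hinj.tendsto_cofinite
    rw [Nat.cofinite_eq_atTop] at ht2
    have hev := ht2.eventually (gt_mem_nhds (zero_lt_one))
    obtain ⟨j0, hj0⟩ := exists_nat_ge (Real.log (B / ‖v i‖))
    obtain ⟨j, hj, hj1⟩ := (hev.and (eventually_ge_atTop (max 1 j0))).exists
    simp only [Function.comp] at hj
    refine absurd hj (not_lt.2 ?_)
    have hstep : ENNReal.ofReal (2 ^ j) ≤ negLogK (K j)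
        (MvPolynomial.eval (fun l => w l) (dehom (fun J => c J / c (I j)) (K j) i))
        (m * Real.log (2 * (1 + ‖w‖))) := by
      rw [negLogK]
      split_ifs with h0
      · exact le_top
      apply ENNReal.ofReal_le_ofReal
      have hL0 : 0 ≤ Real.log (2 * (1 + ‖w‖)) :=
        Real.log_nonneg (by nlinarith [norm_nonneg w])
      have hk0 : (0:ℝ) < K j := by exact_mod_cast hK j
      have he := eval_dehom (fun J => c J / c (I j)) (K j) i (fun l => v l) hvi (fun l => w l) hwv
      have he2 : ∑ J ∈ Finset.Nat.antidiagonalTuple (m + 1) (K j),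
          c J / c (I j) * ∏ l, v l ^ J l = lineCoeff S v (K j) / c (I j) := by
        rw [lineCoeff, Finset.sum_div]
        exact Finset.sum_congr rfl fun J _ => by rw [hc]; ring
      rw [he2] at he
      set y := MvPolynomial.eval (fun l => w l) (dehom (fun J => c J / c (I j)) (K j) i) with hy
      have hn : ‖y‖ * ‖v i‖ ^ K j = ‖lineCoeff S v (K j)‖ / ‖c (I j)‖ := by
        rw [← norm_pow, ← norm_mul, he, norm_div]
      have hyle : ‖y‖ ≤ (B / ‖v i‖ / Real.exp (4 ^ j)) ^ K j := by
        rw [div_pow, div_pow, div_right_comm, le_div_iff₀ (by positivity), hn]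
        exact div_le_div₀ (by positivity) (hBk _ (hK j)) (by positivity) (hbig j).le
      have hlog := Real.log_le_log (norm_pos_iff.2 h0) hyle
      rw [Real.log_pow, Real.log_div (by positivity) (by positivity), Real.log_exp] at hlog
      have hlog2 : Real.log ‖y‖ / K j ≤ Real.log (B / ‖v i‖) - 4 ^ j := by
        rw [div_le_iff₀ hk0]; linarith
      have hjj : (j0 : ℝ) ≤ j := by exact_mod_cast (le_max_right _ _).trans hj1
      have h2j : (j : ℝ) ≤ 2 ^ j := by exact_mod_cast (Nat.lt_two_pow_self (n := j)).le
      have h22 : (2:ℝ) ≤ 2 ^ j := by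
        have := (le_max_left _ _).trans hj1
        calc (2:ℝ) = 2 ^ 1 := by norm_num
          _ ≤ 2 ^ j := pow_le_pow_right₀ (by norm_num) this
      have h4 : (4:ℝ) ^ j = 2 ^ j * 2 ^ j := by rw [← mul_pow]; norm_num
      have hm0 : 0 ≤ (m:ℝ) * Real.log (2 * (1 + ‖w‖)) := by positivity
      nlinarith
    calc (1 : ℝ≥0∞) = 2⁻¹ ^ j * ENNReal.ofReal (2 ^ j) := by
          rw [ENNReal.ofReal_pow (by norm_num), ENNReal.ofReal_ofNat, ← mul_pow,
            ENNReal.inv_mul_cancel (by norm_num) (by norm_num), one_pow]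
      _ ≤ _ := mul_le_mul_right hstep _

end
end

section
/- Let {P_k}_{k≥1} be a sequence of polynomials in ℂ[z₁,…,zₙ] with deg P_k ≤ k for each k. Let F ⊆ ℂⁿ be a set that is not pluripolar (equivalently, c_n(F) ≠ 0), and suppose limsup_{k→∞} (1/k) log |P_k(z)| < ∞ for each z ∈ F. Then for each compact subset K of ℂⁿ there exists a constant M = M(K) > 0 such that (1/k) log |P_k(z)| < log M, i.e., |P_k(z)| < M^k, for all z ∈ K and all k ≥ 1. -/
open MeasureTheory Filter Metric Set
open scoped ENNReal

noncomputable section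

lemma line_poly {n : ℕ} (P : MvPolynomial (Fin n) ℂ) (k : ℕ) (hk : P.totalDegree ≤ k)
    (a b : EuclideanSpace ℂ (Fin n)) :
    ∃ p : Polynomial ℂ, p.natDegree ≤ k ∧
      ∀ t : ℂ, p.eval t = MvPolynomial.eval (fun i => (a + t • b) i) P := by
  refine ⟨MvPolynomial.aeval
    (fun i => Polynomial.C (b i) * Polynomial.X + Polynomial.C (a i)) P, ?_, ?_⟩
  · have := MvPolynomial.aeval_natDegree_le (n := 1) P hk
      (fun i => Polynomial.C (b i) * Polynomial.X + Polynomial.C (a i))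
      (fun i => Polynomial.natDegree_linear_le)
    simpa using this
  · intro t
    rw [MvPolynomial.aeval_def, ← Polynomial.coe_evalRingHom, MvPolynomial.hom_eval₂,
      MvPolynomial.eval, MvPolynomial.coe_eval₂Hom]
    congr 1
    · ext x; simp
    · ext i; simp; ring

lemma poly_growth (p : Polynomial ℂ) (k : ℕ) (hk : p.natDegree ≤ k) (S : ℝ)
    (hS : 0 ≤ S) (h : ∀ t : ℂ, ‖t‖ = 1 → ‖p.eval t‖ ≤ S) (t : ℂ) :
    ‖p.eval t‖ ≤ S * (1 + ‖t‖) ^ k := by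
  have hm : p.mahlerMeasure ≤ S := by
    refine p.mahlerMeasure_le_sqrt_sum_sq_norm_coeff.trans ?_
    apply Real.sqrt_le_iff.2 ⟨hS, ?_⟩
    have h1 := p.sum_sq_norm_coeff_eq_circleAverage
    have h2 : Real.circleAverage (fun θ ↦ ‖p.eval θ‖ ^ 2) 0 1 ≤ S ^ 2 := by
      apply Real.circleAverage_mono_on_of_le_circle
      · apply ContinuousOn.circleIntegrable'
        fun_prop
      · intro x hx
        have := h x (by simpa using hx)
        gcongr
    linarith
  rw [Polynomial.eval_eq_sum_range]
  calc ‖∑ i ∈ Finset.range (p.natDegree + 1), p.coeff i * t ^ i‖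
      ≤ ∑ i ∈ Finset.range (p.natDegree + 1), ‖p.coeff i * t ^ i‖ := norm_sum_le _ _
    _ ≤ ∑ i ∈ Finset.range (p.natDegree + 1), S * (‖t‖ ^ i * (p.natDegree.choose i)) := by
        apply Finset.sum_le_sum
        intro i _
        rw [norm_mul, norm_pow]
        have := p.norm_coeff_le_choose_mul_mahlerMeasure i
        calc ‖p.coeff i‖ * ‖t‖ ^ i ≤ (p.natDegree.choose i * S) * ‖t‖ ^ i := by
              gcongr
              exact this.trans (by gcongr)
          _ = _ := by ring
    _ = S * (1 + ‖t‖) ^ p.natDegree := by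
        rw [← Finset.mul_sum, add_comm 1, add_pow]
        simp
    _ ≤ _ := by
        gcongr
        linarith [norm_nonneg t]

lemma div_mul_le_left {x y : ℝ} (hx : 0 ≤ x) (hy : 0 ≤ y) : x / y * y ≤ x := by
  rcases hy.eq_or_lt with rfl | h
  · simpa using hx
  · exact (div_mul_cancel₀ x h.ne').le

lemma mv_growth {n : ℕ} (P : MvPolynomial (Fin n) ℂ) (k : ℕ) (hk : P.totalDegree ≤ k)
    (a : EuclideanSpace ℂ (Fin n)) (δ : ℝ) (hδ : 0 < δ) (S : ℝ) (hS : 0 ≤ S)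
    (h : ∀ z : EuclideanSpace ℂ (Fin n), ‖z - a‖ ≤ δ → ‖MvPolynomial.eval (fun i => z i) P‖ ≤ S)
    (z : EuclideanSpace ℂ (Fin n)) :
    ‖MvPolynomial.eval (fun i => z i) P‖ ≤ S * (1 + ‖z - a‖ / δ) ^ k := by
  obtain ⟨p, hp, hpe⟩ := line_poly P k hk a (((δ / ‖z - a‖ : ℝ) : ℂ) • (z - a))
  have := poly_growth p k hp S hS (fun t ht => by
    rw [hpe]
    apply h
    rw [add_sub_cancel_left, norm_smul, norm_smul, ht, one_mul, Complex.norm_real, Real.norm_eq_abs,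
      abs_div, abs_norm, abs_of_pos hδ]
    exact div_mul_le_left hδ.le (norm_nonneg _)) ((‖z - a‖ / δ : ℝ) : ℂ)
  rw [hpe, Complex.norm_real, Real.norm_eq_abs, abs_of_nonneg (by positivity)] at this
  convert this using 4
  have : a + (((‖z - a‖ / δ : ℝ) : ℂ) • ((δ / ‖z - a‖ : ℝ) : ℂ) • (z - a)) = z := by
    by_cases hz : ‖z - a‖ = 0
    · rw [norm_eq_zero] at hz
      simp [hz]
      exact (sub_eq_zero.1 hz).symm
    · rw [smul_smul, ← Complex.ofReal_mul]
      have : ‖z - a‖ / δ * (δ / ‖z - a‖) = 1 := by field_simp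
      simp [this]
  rw [this]

lemma poly_submean (p : Polynomial ℂ) (h0 : p.eval 0 ≠ 0) :
    IntegrableOn (fun θ : ℝ => Real.log ‖p.eval (circleMap 0 1 θ)‖) (Set.Ioc 0 (2 * Real.pi)) ∧
    (∀ᵐ θ ∂(volume.restrict (Set.Ioc 0 (2 * Real.pi))), p.eval (circleMap 0 1 θ) ≠ 0) ∧
    Real.log ‖p.eval 0‖ ≤ (2 * Real.pi)⁻¹ *
      ∫ θ in Set.Ioc 0 (2 * Real.pi), Real.log ‖p.eval (circleMap 0 1 θ)‖ := by
  have hp : p ≠ 0 := by rintro rfl; simp at h0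
  refine ⟨?_, ?_, ?_⟩
  · have := p.intervalIntegrable_mahlerMeasure
    rwa [intervalIntegrable_iff_integrableOn_Ioc_of_le (by positivity)] at this
  · apply ae_restrict_of_ae
    have hc : (p.roots.toFinset : Set ℂ).Countable := p.roots.toFinset.countable_toSet
    have := (hc.preimage_circleMap 0 (R := 1) one_ne_zero).ae_notMem volume
    filter_upwards [this] with θ hθ h
    apply hθ
    simp [hp, h]
  · have h1 := p.norm_coeff_le_choose_mul_mahlerMeasure 0
    rw [Polynomial.coeff_zero_eq_eval_zero, Nat.choose_zero_right, Nat.cast_one, one_mul,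
      p.mahlerMeasure_def_of_ne_zero hp, intervalIntegral.integral_of_le (by positivity)] at h1
    exact (Real.log_le_iff_le_exp (norm_pos_iff.2 h0)).2 h1

lemma ptwise_split (H : ℝ) (hH : 0 ≤ H) (S : ℝ≥0∞) :
    erealToENNReal ((H : EReal) - (S : EReal)) + S =
      ENNReal.ofReal H + erealToENNReal (-((H : EReal) - (S : EReal))) := by
  by_cases hS : S = ⊤
  · subst hS
    simp [erealToENNReal]
  · lift S to NNReal using hS
    have e1 : ((H : EReal) - ((S : ℝ≥0∞) : EReal)) = ((H - (S : ℝ) : ℝ) : EReal) := by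
      rw [EReal.coe_sub]; rfl
    rw [e1, ← EReal.coe_neg]
    simp only [erealToENNReal, EReal.coe_ne_top, if_false, EReal.toReal_coe]
    rw [← ENNReal.ofReal_coe_nnreal]
    rcases le_total H S with h | h
    · rw [ENNReal.ofReal_of_nonpos (by linarith), ← ENNReal.ofReal_add hH (by linarith)]
      simp
    · rw [ENNReal.ofReal_of_nonpos (p := -(H - S)) (by linarith),
        ← ENNReal.ofReal_add (by linarith) (NNReal.coe_nonneg S)]
      simp

lemma psh_of_sum {n : ℕ} (H : EuclideanSpace ℂ (Fin n) → ℝ) (hHc : Continuous H)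
    (hH : ∀ z, 0 ≤ H z) (S : EuclideanSpace ℂ (Fin n) → ℝ≥0∞) (hS : LowerSemicontinuous S)
    (z0 : EuclideanSpace ℂ (Fin n)) (hz0 : S z0 ≠ ⊤)
    (hm : ∀ (a b : EuclideanSpace ℂ (Fin n)) (r : ℝ),
      ENNReal.ofReal (2 * Real.pi) * ENNReal.ofReal (H a) +
        ∫⁻ θ in Set.Ioc (0:ℝ) (2 * Real.pi), S (a + (r * Complex.exp (θ * Complex.I)) • b) ≤
      ENNReal.ofReal (2 * Real.pi) * S a +
        ∫⁻ θ in Set.Ioc (0:ℝ) (2 * Real.pi),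
          ENNReal.ofReal (H (a + (r * Complex.exp (θ * Complex.I)) • b))) :
    IsPSH (fun z => (H z : EReal) - (S z : EReal)) := by
  refine ⟨?_, ⟨z0, ?_⟩, ?_, ?_⟩
  · have h1 : UpperSemicontinuous (fun z => (H z : EReal)) :=
      (continuous_coe_real_ereal.comp hHc).upperSemicontinuous
    have h2 : UpperSemicontinuous (fun z => -(S z : EReal)) := by
      have := Continuous.comp_lowerSemicontinuous_antitone (g := fun x : ℝ≥0∞ => -(x : EReal))
        (continuous_coe_ennreal_ereal.neg) hS
        (fun x y h => by simpa using h)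
      exact this
    have := h1.add' h2 (fun x => EReal.continuousAt_add (by simp) (by simp))
    exact this
  · lift S z0 to NNReal using hz0 with s
    have e1 : ((H z0 : EReal) - ((s : ℝ≥0∞) : EReal)) = ((H z0 - (s : ℝ) : ℝ) : EReal) := by
      rw [EReal.coe_sub]; rfl
    rw [e1]
    exact EReal.coe_ne_bot _
  · intro z
    have : (H z : EReal) - (S z : EReal) ≤ (H z : EReal) := by
      calc (H z : EReal) - (S z : EReal) ≤ (H z : EReal) - 0 :=
            EReal.sub_le_sub le_rfl (EReal.coe_ennreal_nonneg _)
        _ = _ := by simp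
    exact (this.trans_lt (EReal.coe_lt_top _)).ne
  · intro a b r hr
    by_cases hSa : S a = ⊤
    · simp [hSa]
    have hm := hm a b r
    have hγ : Continuous (fun θ : ℝ => a + ((r : ℂ) * Complex.exp (θ * Complex.I)) • b) := by
      fun_prop
    set γ := fun θ : ℝ => a + ((r : ℂ) * Complex.exp (θ * Complex.I)) • b with hγd
    set μ : Measure ℝ := volume.restrict (Set.Ioc (0:ℝ) (2 * Real.pi)) with hμ
    have hIH : ∫⁻ θ, ENNReal.ofReal (H (γ θ)) ∂μ ≠ ⊤ := by
      have : IntegrableOn (fun θ => H (γ θ)) (Set.Ioc 0 (2 * Real.pi)) :=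
        ((hHc.comp hγ).integrableOn_Icc).mono_set Set.Ioc_subset_Icc_self
      exact this.lintegral_lt_top.ne
    have hIS : ∫⁻ θ, S (γ θ) ∂μ ≠ ⊤ := by
      have h2 : ENNReal.ofReal (2 * Real.pi) * S a + ∫⁻ θ, ENNReal.ofReal (H (γ θ)) ∂μ ≠ ⊤ :=
        ENNReal.add_ne_top.2 ⟨ENNReal.mul_ne_top ENNReal.ofReal_ne_top hSa, hIH⟩
      exact ne_top_of_le_ne_top h2 (le_add_self.trans hm)
    have hsplit : (∫⁻ θ, erealToENNReal ((H (γ θ) : EReal) - (S (γ θ) : EReal)) ∂μ) +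
        ∫⁻ θ, S (γ θ) ∂μ = (∫⁻ θ, ENNReal.ofReal (H (γ θ)) ∂μ) +
        ∫⁻ θ, erealToENNReal (-((H (γ θ) : EReal) - (S (γ θ) : EReal))) ∂μ := by
      rw [← lintegral_add_right _ (show Measurable (fun θ => S (γ θ)) from hS.measurable.comp hγ.measurable),
        ← lintegral_add_left (show Measurable (fun θ => ENNReal.ofReal (H (γ θ))) from
          (hHc.comp hγ).measurable.ennreal_ofReal)]
      apply lintegral_congr
      intro θ
      exact ptwise_split _ (hH _) _
    have hA : ∫⁻ θ, erealToENNReal ((H (γ θ) : EReal) - (S (γ θ) : EReal)) ∂μ ≠ ⊤ := by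
      refine ne_top_of_le_ne_top hIH (lintegral_mono fun θ => ?_)
      by_cases hSt : S (γ θ) = ⊤
      · simp [hSt, erealToENNReal]
      · lift S (γ θ) to NNReal using hSt with s
        have e1 : ((H (γ θ) : EReal) - ((s : ℝ≥0∞) : EReal)) = ((H (γ θ) - (s : ℝ) : ℝ) : EReal) := by
          rw [EReal.coe_sub]; rfl
        rw [e1]
        simp only [erealToENNReal, EReal.coe_ne_top, if_false, EReal.toReal_coe]
        exact ENNReal.ofReal_le_ofReal (by linarith [s.2, NNReal.coe_nonneg s])
    have hB : ∫⁻ θ, erealToENNReal (-((H (γ θ) : EReal) - (S (γ θ) : EReal))) ∂μ ≠ ⊤ := by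
      have : (∫⁻ θ, ENNReal.ofReal (H (γ θ)) ∂μ) +
        ∫⁻ θ, erealToENNReal (-((H (γ θ) : EReal) - (S (γ θ) : EReal))) ∂μ ≠ ⊤ := by
        rw [← hsplit]; exact ENNReal.add_ne_top.2 ⟨hA, hIS⟩
      exact (ENNReal.add_ne_top.1 this).2
    change (H a : EReal) - (S a : EReal) ≤ (((2 * Real.pi)⁻¹ : ℝ) : EReal) *
      (((∫⁻ θ, erealToENNReal ((H (γ θ) : EReal) - (S (γ θ) : EReal)) ∂μ : ℝ≥0∞) : EReal) -
       ((∫⁻ θ, erealToENNReal (-((H (γ θ) : EReal) - (S (γ θ) : EReal))) ∂μ : ℝ≥0∞) : EReal))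
    generalize (∫⁻ θ, erealToENNReal ((H (γ θ) : EReal) - (S (γ θ) : EReal)) ∂μ) = A at *
    generalize (∫⁻ θ, erealToENNReal (-((H (γ θ) : EReal) - (S (γ θ) : EReal))) ∂μ) = B at *
    change ENNReal.ofReal (2 * Real.pi) * ENNReal.ofReal (H a) + (∫⁻ θ, S (γ θ) ∂μ) ≤
      ENNReal.ofReal (2 * Real.pi) * S a + ∫⁻ θ, ENNReal.ofReal (H (γ θ)) ∂μ at hm
    generalize (∫⁻ θ, S (γ θ) ∂μ) = IS at *
    generalize (∫⁻ θ, ENNReal.ofReal (H (γ θ)) ∂μ) = IH at *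
    generalize S a = Sa at *
    lift A to NNReal using hA
    lift B to NNReal using hB
    lift IS to NNReal using hIS
    lift IH to NNReal using hIH
    lift Sa to NNReal using hSa
    have e : ∀ x y : NNReal, (((x : ℝ≥0∞) : EReal) - ((y : ℝ≥0∞) : EReal)) =
        (((x : ℝ) - (y : ℝ) : ℝ) : EReal) := fun x y => by rw [EReal.coe_sub]; rfl
    have e1 : ((H a : EReal) - ((Sa : ℝ≥0∞) : EReal)) = ((H a - (Sa : ℝ) : ℝ) : EReal) := by
      rw [EReal.coe_sub]; rfl
    rw [e, e1, ← EReal.coe_mul, EReal.coe_le_coe_iff]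
    have hs' : (A : ℝ) + IS = IH + B := by exact_mod_cast hsplit
    have hm' : 2 * Real.pi * H a + IS ≤ 2 * Real.pi * Sa + IH := by
      have := ENNReal.toReal_mono (by finiteness) hm
      rw [ENNReal.toReal_add (by finiteness) (by finiteness),
        ENNReal.toReal_add (by finiteness) (by finiteness), ENNReal.toReal_mul,
        ENNReal.toReal_mul, ENNReal.toReal_ofReal (by positivity),
        ENNReal.toReal_ofReal (hH a)] at this
      simpa using this
    have hpi : 0 < 2 * Real.pi := by positivity
    rw [inv_mul_eq_div, le_div_iff₀ hpi]
    linarith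

/-- the summand -/
def vfun {n : ℕ} (P : MvPolynomial (Fin n) ℂ) (c d s : ℝ) (z : EuclideanSpace ℂ (Fin n)) :
    ℝ≥0∞ :=
  if MvPolynomial.eval (fun i => z i) P = 0 then ⊤
  else ENNReal.ofReal (c * (Real.log (1 + ‖z‖) + s)
    - d * Real.log ‖MvPolynomial.eval (fun i => z i) P‖)

lemma eval_cont {n : ℕ} (P : MvPolynomial (Fin n) ℂ) :
    Continuous (fun z : EuclideanSpace ℂ (Fin n) => MvPolynomial.eval (fun i => z i) P) :=
  (MvPolynomial.continuous_eval P).comp (by fun_prop)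

lemma log_cont {n : ℕ} :
    Continuous (fun z : EuclideanSpace ℂ (Fin n) => Real.log (1 + ‖z‖)) :=
  Continuous.log (by fun_prop) (fun z => by positivity)

lemma vfun_lsc {n : ℕ} (P : MvPolynomial (Fin n) ℂ) (c d s : ℝ) (hd : 0 < d) :
    LowerSemicontinuous (vfun P c d s) := by
  rw [lowerSemicontinuous_iff_isOpen_preimage]
  intro y
  by_cases hy : y = ⊤
  · subst hy; simp
  lift y to NNReal using hy
  have : vfun P c d s ⁻¹' Ioi (y : ℝ≥0∞) = {z | ‖MvPolynomial.eval (fun i => z i) P‖ <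
      Real.exp ((c * (Real.log (1 + ‖z‖) + s) - y) / d)} := by
    ext z
    simp only [mem_preimage, mem_Ioi, vfun]
    split_ifs with h
    · simp [h, Real.exp_pos]
    · change _ ↔ ‖MvPolynomial.eval (fun i => z i) P‖ <
        Real.exp ((c * (Real.log (1 + ‖z‖) + s) - y) / d)
      rw [← Real.log_lt_iff_lt_exp (norm_pos_iff.2 h), lt_div_iff₀ hd,
        ← ENNReal.ofReal_coe_nnreal, ENNReal.ofReal_lt_ofReal_iff']
      constructor
      · rintro ⟨h, _⟩; linarith
      · intro h; exact ⟨by linarith, by linarith [NNReal.coe_nonneg y]⟩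
  rw [this]
  apply isOpen_lt (eval_cont P).norm
  have := log_cont (n := n)
  fun_prop

lemma vfun_submean {n : ℕ} (P : MvPolynomial (Fin n) ℂ) (c d s : ℝ) (hc : 0 ≤ c) (hd : 0 < d)
    (hnn : ∀ z : EuclideanSpace ℂ (Fin n), MvPolynomial.eval (fun i => z i) P ≠ 0 →
      d * Real.log ‖MvPolynomial.eval (fun i => z i) P‖ ≤ c * (Real.log (1 + ‖z‖) + s))
    (a b : EuclideanSpace ℂ (Fin n)) (r : ℝ) :
    ENNReal.ofReal (2 * Real.pi) * ENNReal.ofReal (c * Real.log (1 + ‖a‖)) +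
        ∫⁻ θ in Set.Ioc (0:ℝ) (2 * Real.pi),
          vfun P c d s (a + (r * Complex.exp (θ * Complex.I)) • b) ≤
      ENNReal.ofReal (2 * Real.pi) * vfun P c d s a +
        ∫⁻ θ in Set.Ioc (0:ℝ) (2 * Real.pi),
          ENNReal.ofReal (c * Real.log (1 + ‖a + (r * Complex.exp (θ * Complex.I)) • b‖)) := by
  by_cases ha : MvPolynomial.eval (fun i => a i) P = 0
  · have : ENNReal.ofReal (2 * Real.pi) ≠ 0 := by
      rw [Ne, ENNReal.ofReal_eq_zero, not_le]; positivity
    have hv : vfun P c d s a = ⊤ := by simp [vfun, ha]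
    rw [hv, ENNReal.mul_top this, top_add]
    exact le_top
  have hγ : Continuous (fun θ : ℝ => a + ((r : ℂ) * Complex.exp (θ * Complex.I)) • b) := by
    fun_prop
  obtain ⟨p, -, hp⟩ := line_poly P _ le_rfl a ((r : ℂ) • b)
  have hpγ : ∀ θ : ℝ, p.eval (circleMap 0 1 θ) = MvPolynomial.eval
      (fun i => (a + ((r : ℂ) * Complex.exp (θ * Complex.I)) • b) i) P := by
    intro θ
    rw [hp, smul_smul]
    simp [circleMap, mul_comm]
  have hp0 : p.eval 0 = MvPolynomial.eval (fun i => a i) P := by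
    rw [hp]; simp
  obtain ⟨h1, h2, h3⟩ := poly_submean p (by rwa [hp0])
  simp only [hpγ, hp0] at h1 h2 h3
  set γ := fun θ : ℝ => a + ((r : ℂ) * Complex.exp (θ * Complex.I)) • b with hγd
  set μ : Measure ℝ := volume.restrict (Set.Ioc (0:ℝ) (2 * Real.pi)) with hμ
  change Integrable (fun θ => Real.log ‖MvPolynomial.eval (fun i => γ θ i) P‖) μ at h1
  change ∀ᵐ θ ∂μ, MvPolynomial.eval (fun i => γ θ i) P ≠ 0 at h2
  change _ ≤ _ * ∫ θ, Real.log ‖MvPolynomial.eval (fun i => γ θ i) P‖ ∂μ at h3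
  change _ + ∫⁻ θ, vfun P c d s (γ θ) ∂μ ≤
    _ + ∫⁻ θ, ENNReal.ofReal (c * Real.log (1 + ‖γ θ‖)) ∂μ
  have hlog : ∀ z : EuclideanSpace ℂ (Fin n), 0 ≤ c * Real.log (1 + ‖z‖) := fun z =>
    mul_nonneg hc (Real.log_nonneg (by linarith [norm_nonneg z]))
  have hHi : Integrable (fun θ => c * Real.log (1 + ‖γ θ‖)) μ := by
    have : IntegrableOn (fun θ => c * Real.log (1 + ‖γ θ‖)) (Set.Ioc 0 (2 * Real.pi)) :=
      ((continuous_const.mul (log_cont.comp hγ)).integrableOn_Icc).mono_set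
        Set.Ioc_subset_Icc_self
    exact this
  have hci : Integrable (fun _ : ℝ => c * s) μ := integrable_const _
  have hvi : Integrable (fun θ => c * Real.log (1 + ‖γ θ‖) + c * s -
      d * Real.log ‖MvPolynomial.eval (fun i => γ θ i) P‖) μ :=
    (hHi.add hci).sub (h1.const_mul d)
  have hv : ∫⁻ θ, vfun P c d s (γ θ) ∂μ = ENNReal.ofReal (∫ θ, (c * Real.log (1 + ‖γ θ‖) + c * s -
      d * Real.log ‖MvPolynomial.eval (fun i => γ θ i) P‖) ∂μ) := by
    rw [ofReal_integral_eq_lintegral_ofReal hvi]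
    · apply lintegral_congr_ae
      filter_upwards [h2] with θ hθ
      simp only [vfun, hθ, if_false]
      rw [mul_add]
    · filter_upwards [h2] with θ hθ
      have := hnn (γ θ) hθ
      simp only [Pi.zero_apply]
      linarith
  rw [hv, ← ofReal_integral_eq_lintegral_ofReal hHi (Eventually.of_forall fun θ => hlog _)]
  simp only [vfun, ha, if_false]
  have hpi : 0 < 2 * Real.pi := by positivity
  have hna := hnn a ha
  rw [← ENNReal.ofReal_mul hpi.le, ← ENNReal.ofReal_mul hpi.le,
    ← ENNReal.ofReal_add, ← ENNReal.ofReal_add]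
  · apply ENNReal.ofReal_le_ofReal
    have hadd : Integrable (fun θ => c * Real.log (1 + ‖γ θ‖) + c * s) μ := hHi.add hci
    rw [integral_sub hadd (h1.const_mul d), integral_add hHi hci, integral_const_mul d,
      integral_const]
    have hvol : μ.real univ = 2 * Real.pi := by
      simp [hμ, measureReal_def, Real.pi_pos.le]
    rw [hvol, smul_eq_mul]
    rw [inv_mul_eq_div, le_div_iff₀ hpi] at h3
    have := mul_le_mul_of_nonneg_left h3 hd.le
    linarith
  · exact mul_nonneg hpi.le (by linarith)
  · exact integral_nonneg fun θ => hlog _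
  · exact mul_nonneg hpi.le (hlog a)
  · apply integral_nonneg_of_ae
    filter_upwards [h2] with θ hθ
    have := hnn (γ θ) hθ
    simp only [Pi.zero_apply]
    linarith

/-- **Higher-dimensional Lelong-type estimate.** If `deg P_k ≤ k`, `F` is not pluripolar,
and `limsup (1/k) log |P_k(z)| < ∞` for each `z ∈ F`, then for each compact `K` there is
`M > 0` with `|P_k(z)| < M^k` for all `z ∈ K` and `k ≥ 1`. -/
theorem lelong_estimate {n : ℕ} (P : ℕ → MvPolynomial (Fin n) ℂ)
    (hdeg : ∀ k : ℕ, 1 ≤ k → (P k).totalDegree ≤ k)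
    (F : Set (EuclideanSpace ℂ (Fin n))) (hF : ¬ Pluripolar F)
    (hbdd : ∀ z ∈ F, Filter.IsBoundedUnder (· ≤ ·) Filter.atTop
      (fun k : ℕ => (k : ℝ)⁻¹ * Real.log ‖MvPolynomial.eval (fun i => z i) (P k)‖)) :
    ∀ K : Set (EuclideanSpace ℂ (Fin n)), IsCompact K →
      ∃ M : ℝ, 0 < M ∧ ∀ z ∈ K, ∀ k : ℕ, 1 ≤ k →
        ‖MvPolynomial.eval (fun i => z i) (P k)‖ < M ^ k := by
  classical
  intro K hK
  have hmax : ∀ k, ∃ x : EuclideanSpace ℂ (Fin n), ‖x‖ ≤ 1 ∧ ∀ z : EuclideanSpace ℂ (Fin n),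
      ‖z‖ ≤ 1 → ‖MvPolynomial.eval (fun i => z i) (P k)‖ ≤
        ‖MvPolynomial.eval (fun i => x i) (P k)‖ := by
    intro k
    obtain ⟨x, hx, hx'⟩ := (isCompact_closedBall (0 : EuclideanSpace ℂ (Fin n)) 1).exists_isMaxOn
      ⟨0, by simp⟩ ((eval_cont (P k)).norm.continuousOn)
    refine ⟨x, by simpa using hx, fun z hz => hx' (by simpa using hz)⟩
  choose x hx1 hxm using hmax
  set S : ℕ → ℝ := fun k => ‖MvPolynomial.eval (fun i => x k i) (P k)‖ with hSdef
  have hS0 : ∀ k, 0 ≤ S k := fun k => norm_nonneg _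
  have hgrow : ∀ k, 1 ≤ k → ∀ z : EuclideanSpace ℂ (Fin n),
      ‖MvPolynomial.eval (fun i => z i) (P k)‖ ≤ S k * (1 + ‖z‖) ^ k := by
    intro k hk z
    have := mv_growth (P k) k (hdeg k hk) 0 1 one_pos (S k) (hS0 k)
      (fun z hz => hxm k z (by simpa using hz)) z
    simpa using this
  by_cases hb : ∃ M : ℝ, ∀ k, 1 ≤ k → S k ≤ M ^ k
  · obtain ⟨M, hM⟩ := hb
    obtain ⟨R, hR⟩ := hK.isBounded.exists_norm_le
    refine ⟨|M| * (1 + |R|) + 1, by positivity, fun z hz k hk => ?_⟩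
    calc ‖MvPolynomial.eval (fun i => z i) (P k)‖ ≤ S k * (1 + ‖z‖) ^ k := hgrow k hk z
      _ ≤ |M| ^ k * (1 + |R|) ^ k := by
          gcongr
          · exact (hM k hk).trans ((le_abs_self _).trans (abs_pow M k).le)
          · exact (hR z hz).trans (le_abs_self R)
      _ = (|M| * (1 + |R|)) ^ k := (mul_pow _ _ _).symm
      _ < _ := pow_lt_pow_left₀ (by linarith) (by positivity) (by omega)
  exfalso
  apply hF
  push Not at hb
  set w : ℕ → ℝ := fun k => Real.sqrt (Real.log (S k) / k) with hw
  let good : ℕ → ℕ → Prop := fun N k => 1 ≤ k ∧ N ≤ k ∧ 0 < S k ∧ (N : ℝ) ≤ w k ∧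
    Real.log (S k) = k * w k ^ 2
  have hgood : ∀ N, ∃ k, good N k := by
    intro N
    obtain ⟨k, hk, hlt⟩ := hb (Real.exp ((N : ℝ) ^ 2) + ∑ i ∈ Finset.range N, S i)
    have hsum : 0 ≤ ∑ i ∈ Finset.range N, S i := Finset.sum_nonneg fun i _ => hS0 i
    have he : 1 ≤ Real.exp ((N : ℝ) ^ 2) := Real.one_le_exp (by positivity)
    have hNk : N ≤ k := by
      by_contra hcon
      push Not at hcon
      have h1 : S k ≤ ∑ i ∈ Finset.range N, S i :=
        Finset.single_le_sum (fun i _ => hS0 i) (Finset.mem_range.2 hcon)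
      have h2 := le_self_pow₀ (a := Real.exp ((N : ℝ) ^ 2) + ∑ i ∈ Finset.range N, S i)
        (by linarith) (show k ≠ 0 by omega)
      linarith
    have hlt' : Real.exp (k * (N : ℝ) ^ 2) < S k := by
      rw [Real.exp_nat_mul]
      refine lt_of_le_of_lt ?_ hlt
      gcongr
      linarith
    have hSp : 0 < S k := (Real.exp_pos _).trans hlt'
    have hl : k * (N : ℝ) ^ 2 < Real.log (S k) := (Real.lt_log_iff_exp_lt hSp).2 hlt'
    have hk0 : (0 : ℝ) < k := by exact_mod_cast hk
    have hd : (N : ℝ) ^ 2 ≤ Real.log (S k) / k := by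
      rw [le_div_iff₀ hk0]; linarith
    refine ⟨k, hk, hNk, hSp, Real.le_sqrt_of_sq_le hd, ?_⟩
    have := Real.sq_sqrt ((by positivity : (0 : ℝ) ≤ (N : ℝ) ^ 2).trans hd)
    simp only [hw]
    rw [this]
    field_simp
  let G : ℕ → Set (EuclideanSpace ℂ (Fin n)) := fun N => ⋃ k ∈ {k | good N k},
    {z | S k * Real.exp (-(k * w k)) < ‖MvPolynomial.eval (fun i => z i) (P k)‖}
  have hGo : ∀ N, IsOpen (G N) := fun N =>
    isOpen_biUnion fun k _ => isOpen_lt continuous_const (eval_cont (P k)).norm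
  have hGd : ∀ N, Dense (G N) := by
    intro N
    rw [Metric.dense_iff]
    intro y r hr
    by_contra hcon
    set A : ℝ := 1 + (1 + ‖y‖) / (r / 2) with hA
    have hApos : 0 < A := by positivity
    obtain ⟨N', hN'⟩ := exists_nat_gt (Real.log A)
    obtain ⟨k, hk1, hk2, hk3, hk4, hk5⟩ := hgood (max N N')
    have hle : ∀ z : EuclideanSpace ℂ (Fin n), ‖z - y‖ ≤ r / 2 →
        ‖MvPolynomial.eval (fun i => z i) (P k)‖ ≤ S k * Real.exp (-(k * w k)) := by
      intro z hz
      by_contra hlt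
      push Not at hlt
      apply hcon
      refine ⟨z, ?_, ?_⟩
      · rw [mem_ball, dist_eq_norm]; linarith
      · refine mem_biUnion (x := k) ?_ hlt
        refine ⟨hk1, (le_max_left _ _).trans hk2, hk3, le_trans ?_ hk4, hk5⟩
        exact_mod_cast le_max_left _ _
    have h1 := mv_growth (P k) k (hdeg k hk1) y (r / 2) (by positivity) _
      (by have := hS0 k; positivity) hle (x k)
    have h2 : (1 + ‖x k - y‖ / (r / 2)) ^ k ≤ A ^ k := by
      rw [hA]
      gcongr
      exact (norm_sub_le _ _).trans (by linarith [hx1 k])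
    have hwA : Real.log A < w k := by
      refine hN'.trans_le (le_trans ?_ hk4)
      exact_mod_cast le_max_right _ _
    have hk0 : (0 : ℝ) < k := by exact_mod_cast hk1
    have h3 : A ^ k = Real.exp (k * Real.log A) := by
      rw [Real.exp_nat_mul, Real.exp_log hApos]
    have h4 : Real.exp (-(k * w k)) * A ^ k < 1 := by
      rw [h3, ← Real.exp_add, Real.exp_lt_one_iff]
      nlinarith
    have h5 : S k ≤ S k * (Real.exp (-(k * w k)) * A ^ k) := by
      calc S k ≤ S k * Real.exp (-(k * w k)) * (1 + ‖x k - y‖ / (r / 2)) ^ k := h1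
        _ ≤ S k * Real.exp (-(k * w k)) * A ^ k := by gcongr
        _ = _ := by ring
    nlinarith
  obtain ⟨z0, hz0⟩ := (dense_iInter_of_isOpen hGo hGd).nonempty
  have hκ : ∀ j : ℕ, ∃ k, good (4 ^ j) k ∧
      S k * Real.exp (-(k * w k)) < ‖MvPolynomial.eval (fun i => z0 i) (P k)‖ := by
    intro j
    have := mem_iInter.1 hz0 (4 ^ j)
    simp only [G, mem_iUnion] at this
    obtain ⟨k, hk, hk'⟩ := this
    exact ⟨k, hk, hk'⟩
  choose κ hκ hκz using hκ
  have hκ1 : ∀ j, (0 : ℝ) < κ j := fun j => by exact_mod_cast (hκ j).1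
  have hκw : ∀ j, (4 : ℝ) ^ j ≤ w (κ j) := fun j => by exact_mod_cast (hκ j).2.2.2.1
  have hκS : ∀ j, 0 < S (κ j) := fun j => (hκ j).2.2.1
  have hκl : ∀ j, Real.log (S (κ j)) = κ j * w (κ j) ^ 2 := fun j => (hκ j).2.2.2.2
  have hw1 : ∀ j, 1 ≤ w (κ j) := fun j => (one_le_pow₀ (by norm_num)).trans (hκw j)
  have hw0 : ∀ j, 0 < w (κ j) := fun j => one_pos.trans_le (hw1 j)
  set c : ℕ → ℝ := fun j => (2 ^ j * w (κ j))⁻¹ with hc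
  have hc0 : ∀ j, 0 < c j := fun j => by have := hw0 j; positivity
  have hcw : ∀ j, c j * w (κ j) = (1 / 2) ^ j := fun j => by
    have := (hw0 j).ne'
    simp only [hc]
    field_simp
    rw [← mul_pow]; norm_num
  have hc2 : ∀ j, c j ≤ (1 / 2) ^ j := fun j => by
    rw [← hcw j]
    exact le_mul_of_one_le_right (hc0 j).le (hw1 j)
  have hcs : Summable c := Summable.of_nonneg_of_le (fun j => (hc0 j).le) hc2
    (summable_geometric_of_lt_one (by norm_num) (by norm_num))
  have hh : ∀ z : EuclideanSpace ℂ (Fin n), 0 ≤ Real.log (1 + ‖z‖) := fun z =>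
    Real.log_nonneg (by linarith [norm_nonneg z])
  set v : ℕ → EuclideanSpace ℂ (Fin n) → ℝ≥0∞ := fun j =>
    vfun (P (κ j)) (c j) (c j / κ j) (w (κ j) ^ 2) with hv
  have hlsc : ∀ j, LowerSemicontinuous (v j) := fun j =>
    vfun_lsc _ _ _ _ (div_pos (hc0 j) (hκ1 j))
  have hnn : ∀ j, ∀ z : EuclideanSpace ℂ (Fin n),
      MvPolynomial.eval (fun i => z i) (P (κ j)) ≠ 0 →
      c j / κ j * Real.log ‖MvPolynomial.eval (fun i => z i) (P (κ j))‖ ≤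
        c j * (Real.log (1 + ‖z‖) + w (κ j) ^ 2) := by
    intro j z hz
    have h1 := Real.log_le_log (norm_pos_iff.2 hz) (hgrow (κ j) (hκ j).1 z)
    rw [Real.log_mul (hκS j).ne' (by positivity), hκl, Real.log_pow] at h1
    have := hκ1 j
    calc _ ≤ c j / κ j * (κ j * w (κ j) ^ 2 + κ j * Real.log (1 + ‖z‖)) :=
          mul_le_mul_of_nonneg_left h1 (div_pos (hc0 j) (hκ1 j)).le
      _ = _ := by field_simp; ring
  have hsub := fun j => vfun_submean (P (κ j)) (c j) (c j / κ j) (w (κ j) ^ 2) (hc0 j).le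
    (div_pos (hc0 j) (hκ1 j)) (hnn j)
  refine ⟨_, psh_of_sum (fun z => (∑' j, c j) * Real.log (1 + ‖z‖))
    (continuous_const.mul log_cont) (fun z => mul_nonneg (tsum_nonneg fun j => (hc0 j).le) (hh z))
    (fun z => ∑' j, v j z) (lowerSemicontinuous_tsum hlsc) z0 ?_ ?_, ?_⟩
  · have hs : Summable (fun j : ℕ => (1 / 2 : ℝ) ^ j * (Real.log (1 + ‖z0‖) + 1)) :=
      (summable_geometric_of_lt_one (by norm_num) (by norm_num)).mul_right _
    refine ne_top_of_le_ne_top hs.tsum_ofReal_ne_top (ENNReal.tsum_le_tsum fun j => ?_)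
    have hpos : 0 < S (κ j) * Real.exp (-(κ j * w (κ j))) := mul_pos (hκS j) (Real.exp_pos _)
    have hne : MvPolynomial.eval (fun i => z0 i) (P (κ j)) ≠ 0 :=
      norm_pos_iff.1 (hpos.trans (hκz j))
    simp only [hv, vfun, hne, if_false]
    apply ENNReal.ofReal_le_ofReal
    have h1 := Real.log_le_log hpos (hκz j).le
    rw [Real.log_mul (hκS j).ne' (Real.exp_pos _).ne', Real.log_exp, hκl] at h1
    have h2 : c j / κ j * (κ j * w (κ j) ^ 2 + -(κ j * w (κ j))) ≤ _ :=
      mul_le_mul_of_nonneg_left h1 (div_pos (hc0 j) (hκ1 j)).le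
    have h3 : c j / κ j * (κ j * w (κ j) ^ 2 + -(κ j * w (κ j))) =
        c j * w (κ j) ^ 2 - c j * w (κ j) := by
      have := (hκ1 j).ne'
      field_simp; ring
    rw [h3, hcw] at h2
    have h4 := mul_le_mul_of_nonneg_right (hc2 j) (hh z0)
    rw [mul_add, mul_add]
    linarith
  · intro a b r
    have hpt : ∀ z : EuclideanSpace ℂ (Fin n), ENNReal.ofReal ((∑' j, c j) * Real.log (1 + ‖z‖)) =
        ∑' j, ENNReal.ofReal (c j * Real.log (1 + ‖z‖)) := by
      intro z
      rw [← tsum_mul_right]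
      exact ENNReal.ofReal_tsum_of_nonneg (fun j => mul_nonneg (hc0 j).le (hh z))
        (hcs.mul_right _)
    have hγ : Continuous (fun θ : ℝ => a + ((r : ℂ) * Complex.exp (θ * Complex.I)) • b) := by
      fun_prop
    simp only [hpt]
    rw [lintegral_tsum, lintegral_tsum, ← ENNReal.tsum_mul_left, ← ENNReal.tsum_mul_left,
      ← ENNReal.tsum_add, ← ENNReal.tsum_add]
    · exact ENNReal.tsum_le_tsum fun j => hsub j a b r
    · intro j
      exact ((continuous_const.mul (log_cont.comp hγ)).measurable.ennreal_ofReal).aemeasurable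
    · intro j
      exact ((hlsc j).measurable.comp hγ.measurable).aemeasurable
  · intro z hz
    obtain ⟨C, hC⟩ := hbdd z hz
    rw [eventually_map, eventually_atTop] at hC
    obtain ⟨k0, hC⟩ := hC
    have htop : ∑' j, v j z = ⊤ := by
      by_contra hne
      have ht := ENNReal.tendsto_atTop_zero_of_tsum_ne_top hne
      have hev := ht.eventually (gt_mem_nhds (zero_lt_one' ℝ≥0∞))
      obtain ⟨j0, hj0⟩ := exists_nat_gt (2 * C)
      obtain ⟨j, hj, hj1, hj2, hj3⟩ := (hev.and ((eventually_ge_atTop j0).and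
        ((eventually_ge_atTop k0).and (eventually_ge_atTop 1)))).exists
      apply absurd hj
      rw [not_lt]
      simp only [hv, vfun]
      split_ifs with h0
      · exact le_top
      rw [← ENNReal.ofReal_one]
      apply ENNReal.ofReal_le_ofReal
      have hj4 : j < 4 ^ j := Nat.lt_pow_self (by norm_num)
      have h1 := hC (κ j) (hj2.trans (hj4.le.trans (hκ j).2.1))
      have h2 := mul_le_mul_of_nonneg_left h1 (hc0 j).le
      rw [← mul_assoc, ← div_eq_mul_inv] at h2
      have hq : (2 : ℝ) ≤ 2 ^ j := le_self_pow₀ (by norm_num) (by omega)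
      have hw4 := hκw j
      have hwC : 2 * C ≤ w (κ j) := by
        have : (j : ℝ) < 4 ^ j := by exact_mod_cast hj4
        have : (j0 : ℝ) ≤ j := by exact_mod_cast hj1
        linarith
      have h44 : (4 : ℝ) ^ j = 2 ^ j * 2 ^ j := by rw [← mul_pow]; norm_num
      rw [h44] at hw4
      have hwp := hw1 j
      have h3 : 2 ^ j * w (κ j) ≤ w (κ j) ^ 2 - C := by
        have h5 : 2 * 2 ^ j ≤ w (κ j) := by nlinarith
        nlinarith
      have h4 : 1 ≤ c j * (w (κ j) ^ 2 - C) := by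
        have : c j * (2 ^ j * w (κ j)) = 1 := by
          have := hw0 j
          exact inv_mul_cancel₀ (by positivity)
        rw [← this]
        exact mul_le_mul_of_nonneg_left h3 (hc0 j).le
      have h6 := mul_nonneg (hc0 j).le (hh z)
      rw [mul_add]
      linarith
    simp only [htop]
    simp

end
end
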